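/- arXiv:2407.15997 — 2 statements merged into one kernel-verified Lean document; each statement's English description precedes it below -/
import Mathlib

section
/- Let v ∈ L¹(𝔻) be a weight satisfying: (i) for every r < 1 there exists δ_r > 0 with v(z) > δ_r for almost every z ∈ r𝔻, and (ii) for every r < 1, v(z) ≤ v(rz) for almost every z ∈ 𝔻. For n ∈ ℤ₊, let ℋ_{v,n} = {F holomorphic on 𝔻 : ‖F‖²_{v,n} := Σ_{k=0}^n ∫_𝔻 |F^{(k)}|² v dA < ∞}, where F^{(k)} is the k-th derivative and dA is normalized area measure on 𝔻. Then ℋ_{v,n} is a Hilbert space of holomorphic functions on 𝔻 satisfying (P1)–(P3) (polynomials are dense, point evaluations at points of 𝔻 are continuous, and the shift F ↦ zF is bounded), and its maximal domain Ω_max is contained in the closed unit disk. -/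
open Metric

/-- The normalized area measure `dA = dx dy / π` on `ℂ`. -/
noncomputable def dA : MeasureTheory.Measure ℂ :=
  (ENNReal.ofReal Real.pi)⁻¹ • MeasureTheory.volume

/-- A Hilbert function space on the unit disk `𝔻`: a (complex) Hilbert space of
holomorphic functions on `𝔻` satisfying (P1) (polynomials belong to the space and
are dense), (P2) (point evaluations at points of `𝔻` are continuous) and
(P3) (the shift `F ↦ zF` is a bounded linear self map). -/
structure DiskHilbertSpace where
  carrier : Type
  [nacg : NormedAddCommGroup carrier]
  [ips : InnerProductSpace ℂ carrier]
  [complete : CompleteSpace carrier]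
  /-- The realization of elements as (holomorphic) functions on `𝔻`. -/
  toFun : carrier →ₗ[ℂ] (ℂ → ℂ)
  holo : ∀ F, DifferentiableOn ℂ (toFun F) (ball (0 : ℂ) 1)
  inj : ∀ F G, Set.EqOn (toFun F) (toFun G) (ball (0 : ℂ) 1) → F = G
  /-- The polynomials, as elements of the space. -/
  poly : Polynomial ℂ →ₗ[ℂ] carrier
  poly_eval : ∀ (p : Polynomial ℂ), ∀ z ∈ ball (0 : ℂ) 1,
    toFun (poly p) z = Polynomial.eval z p
  /-- (P1): polynomials are dense. -/
  dense_poly : Dense (Set.range fun p : Polynomial ℂ => poly p)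
  /-- (P2): point evaluations at points of `𝔻` are continuous. -/
  eval_cont : ∀ z ∈ ball (0 : ℂ) 1, Continuous fun F : carrier => toFun F z
  /-- (P3): the shift operator, a bounded linear self map. -/
  shift : carrier →L[ℂ] carrier
  shift_eval : ∀ F, ∀ z ∈ ball (0 : ℂ) 1, toFun (shift F) z = z * toFun F z

attribute [instance] DiskHilbertSpace.nacg DiskHilbertSpace.ips DiskHilbertSpace.complete

/-- The maximal domain `Ω_max`: all `w ∈ ℂ` such that evaluation at `w`, defined on
polynomials, extends to a bounded linear functional on the space. -/
def DiskHilbertSpace.maxDomain (H : DiskHilbertSpace) : Set ℂ :=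
  {w | ∃ Λ : H.carrier →L[ℂ] ℂ, ∀ p : Polynomial ℂ, Λ (H.poly p) = Polynomial.eval w p}

open MeasureTheory

/-- The square of the norm `‖f‖²_{v,n} = ∑_{k=0}^n ∫_𝔻 |f^{(k)}|² v dA`. -/
noncomputable def diskNormSq (v : ℂ → ℝ) (n : ℕ) (f : ℂ → ℂ) : ℝ :=
  ∑ k ∈ Finset.range (n + 1),
    ∫ z in ball (0 : ℂ) 1, ‖iteratedDeriv k f z‖ ^ 2 * v z ∂dA

/-- Membership in `ℋ_{v,n}`: `f` is holomorphic on `𝔻` and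
`∫_𝔻 |f^{(k)}|² v dA < ∞` for all `0 ≤ k ≤ n`. -/
def MemHvn (v : ℂ → ℝ) (n : ℕ) (f : ℂ → ℂ) : Prop :=
  DifferentiableOn ℂ f (ball (0 : ℂ) 1) ∧
    ∀ k ≤ n, IntegrableOn (fun z => ‖iteratedDeriv k f z‖ ^ 2 * v z) (ball (0 : ℂ) 1) dA

open Filter Topology
open scoped ENNReal

section HolomorphicFunctions

theorem differentiableOn_iteratedDeriv {f : ℂ → ℂ} {U : Set ℂ} (hU : IsOpen U)
    (hf : DifferentiableOn ℂ f U) (k : ℕ) : DifferentiableOn ℂ (iteratedDeriv k f) U := by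
  induction k with
  | zero => simpa using hf
  | succ k ih => rw [iteratedDeriv_succ]; exact ih.deriv hU

theorem TendstoLocallyUniformlyOn.iteratedDeriv_of_isOpen {ι : Type*} {l : Filter ι}
    {F : ι → ℂ → ℂ} {f : ℂ → ℂ} {U : Set ℂ} (hF : TendstoLocallyUniformlyOn F f l U)
    (hd : ∀ i, DifferentiableOn ℂ (F i) U) (hU : IsOpen U) (k : ℕ) :
    TendstoLocallyUniformlyOn (fun i => iteratedDeriv k (F i)) (iteratedDeriv k f) l U := by
  induction k with
  | zero => simpa using hF
  | succ k ih =>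
    simp only [iteratedDeriv_succ]
    exact ih.deriv (.of_forall fun i => differentiableOn_iteratedDeriv hU (hd i) k) hU

theorem iteratedDeriv_comp_mul_left (f : ℂ → ℂ) (c : ℂ) (k : ℕ) :
    iteratedDeriv k (fun z => f (c * z)) = fun z => c ^ k * iteratedDeriv k f (c * z) := by
  induction k with
  | zero => simp
  | succ k ih =>
    ext z
    rw [iteratedDeriv_succ, ih, deriv_const_mul_field, deriv_comp_mul_left, iteratedDeriv_succ,
      smul_eq_mul, pow_succ, mul_assoc]

/-- A function holomorphic on the unit disk is approximated on smaller disks by polynomials,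
uniformly and together with all its derivatives. -/
theorem exists_polynomial_tendstoUniformlyOn {f : ℂ → ℂ}
    (hf : DifferentiableOn ℂ f (ball 0 1)) {r : ℝ} (hr : 0 < r) (hr1 : r < 1) :
    ∃ p : ℕ → Polynomial ℂ, ∀ k, TendstoUniformlyOn
      (fun N => iteratedDeriv k fun z => (p N).eval z) (iteratedDeriv k f) atTop
      (closedBall 0 r) := by
  obtain ⟨R, hrR, hR1⟩ := exists_between hr1
  have hR : 0 < R := hr.trans hrR
  lift R to NNReal using hR.le
  have hps := (hf.mono (closedBall_subset_ball hR1)).hasFPowerSeriesOnBall (by exact_mod_cast hR)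
  have ht := hps.tendstoLocallyUniformlyOn
  simp only [zero_add, Metric.eball_coe] at ht
  refine ⟨fun N => ∑ k ∈ Finset.range N,
    Polynomial.monomial k ((cauchyPowerSeries f 0 R).coeff k), fun k => ?_⟩
  have hp : ∀ N, (cauchyPowerSeries f 0 R).partialSum N = fun z => (∑ k ∈ Finset.range N,
      Polynomial.monomial k ((cauchyPowerSeries f 0 R).coeff k)).eval z := by
    intro N
    ext z
    rw [FormalMultilinearSeries.partialSum, Polynomial.eval_finsetSum]
    refine Finset.sum_congr rfl fun k _ => ?_
    rw [FormalMultilinearSeries.apply_eq_pow_smul_coeff, Polynomial.eval_monomial, smul_eq_mul,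
      mul_comm]
  have ht' : TendstoLocallyUniformlyOn (fun N z => (∑ k ∈ Finset.range N,
      Polynomial.monomial k ((cauchyPowerSeries f 0 R).coeff k)).eval z) f atTop
      (ball 0 (R : ℝ)) := by
    refine ht.congr fun N z _ => ?_
    rw [hp]
  exact (tendstoLocallyUniformlyOn_iff_forall_isCompact isOpen_ball).1
    (ht'.iteratedDeriv_of_isOpen (fun N => (Polynomial.differentiable _).differentiableOn)
      isOpen_ball k) _ (closedBall_subset_ball hrR) (isCompact_closedBall _ _)

/-- The area version of the mean value inequality for `|f|²`. -/
theorem enorm_sq_mul_le_setLIntegral_ball {f : ℂ → ℂ} {c : ℂ} {ρ : ℝ}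
    (hf : DifferentiableOn ℂ f (ball c ρ)) :
    ‖f c‖ₑ ^ 2 * (∫⁻ r in Set.Ioo 0 ρ, ENNReal.ofReal r) ≤ ∫⁻ z in ball c ρ, ‖f z‖ₑ ^ 2 := by
  set g : ℂ → ℝ≥0∞ := (ball (0 : ℂ) ρ).indicator fun z => ‖f (c + z)‖ₑ ^ 2 with hg
  have hmap : Set.MapsTo (fun z => c + z) (ball (0 : ℂ) ρ) (ball c ρ) := fun z hz => by
    simpa using hz
  have hcont : ContinuousOn (fun z => ‖f (c + z)‖ₑ ^ 2) (ball (0 : ℂ) ρ) :=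
    (ENNReal.continuous_pow 2).comp_continuousOn
      ((hf.continuousOn.comp (by fun_prop) hmap).enorm)
  have hgm : Measurable g := by
    classical
    rw [hg, ← Set.piecewise_eq_indicator]
    exact hcont.measurable_piecewise continuousOn_const measurableSet_ball
  have h1 : ∫⁻ z in ball c ρ, ‖f z‖ₑ ^ 2 = ∫⁻ z, g z := by
    rw [lintegral_indicator measurableSet_ball, ← lintegral_indicator measurableSet_ball,
      ← lintegral_indicator measurableSet_ball, ← lintegral_add_left_eq_self _ c]
    congr 1
    ext z
    simp [Set.indicator]
  have hsymm : Continuous fun p : ℝ × ℝ => Complex.polarCoord.symm p := by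
    simp only [Complex.polarCoord_symm_apply]
    fun_prop
  rw [h1, ← Complex.lintegral_comp_polarCoord_symm, polarCoord_target, Measure.volume_eq_prod,
    ← Measure.prod_restrict, lintegral_prod _ (by
      simp only [smul_eq_mul]
      exact ((by fun_prop : Measurable fun p : ℝ × ℝ => ENNReal.ofReal p.1).mul
        (hgm.comp hsymm.measurable)).aemeasurable)]
  have key : ∀ r ∈ Set.Ioo 0 ρ, ‖f c‖ₑ ^ 2 ≤
      ∫⁻ θ in Set.Ioo (-Real.pi) Real.pi, g (Complex.polarCoord.symm (r, θ)) := by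
    intro r hr
    have hsub : closedBall c |r| ⊆ ball c ρ := by
      rw [abs_of_pos hr.1]; exact closedBall_subset_ball hr.2
    have hdc : DiffContOnCl ℂ (fun z => f z ^ 2) (ball c |r|) :=
      ((hf.mono hsub).pow 2).diffContOnCl_ball subset_rfl
    have hmean := hdc.circleAverage
    have hper : Function.Periodic (fun θ => f (circleMap c r θ) ^ 2) (2 * Real.pi) := fun θ => by
      simp only [periodic_circleMap c r θ]
    have hgc : ∀ θ : ℝ, g (Complex.polarCoord.symm (r, θ)) = ‖f (circleMap c r θ) ^ 2‖ₑ := by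
      intro θ
      have h : c + Complex.polarCoord.symm (r, θ) = circleMap c r θ := by
        simp [Complex.polarCoord_symm_apply, circleMap, Complex.exp_mul_I]
      have hm : Complex.polarCoord.symm (r, θ) ∈ ball (0 : ℂ) ρ := by
        have : dist (circleMap c r θ) c < ρ :=
          hsub (sphere_subset_closedBall (circleMap_mem_sphere' c r θ))
        rwa [← h, dist_eq_norm, add_sub_cancel_left, ← mem_ball_zero_iff] at this
      rw [hg, Set.indicator_of_mem hm, h, enorm_pow]
    simp only [hgc]
    rw [Real.circleAverage] at hmean
    have h0 := hper.intervalIntegral_add_eq 0 (-Real.pi)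
    rw [zero_add, show -Real.pi + 2 * Real.pi = Real.pi by ring] at h0
    rw [h0, intervalIntegral.integral_of_le (by linarith [Real.pi_pos]),
      integral_Ioc_eq_integral_Ioo] at hmean
    rw [← enorm_pow, ← hmean, enorm_smul]
    refine (mul_le_mul' ?_ (enorm_integral_le_lintegral_enorm _)).trans_eq (one_mul _)
    rw [Real.enorm_eq_ofReal (by positivity), ENNReal.ofReal_le_one]
    exact inv_le_one_of_one_le₀ (by linarith [Real.pi_gt_three])
  rw [← lintegral_const_mul _ (by fun_prop)]
  calc _ ≤ ∫⁻ r in Set.Ioo 0 ρ, ∫⁻ θ in Set.Ioo (-Real.pi) Real.pi,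
        ENNReal.ofReal r • g (Complex.polarCoord.symm (r, θ)) := ?_
    _ ≤ _ := lintegral_mono_set Set.Ioo_subset_Ioi_self
  refine setLIntegral_mono' measurableSet_Ioo fun r hr => ?_
  simp only [smul_eq_mul]
  rw [lintegral_const_mul' _ _ (by simp), mul_comm]
  exact mul_le_mul' le_rfl (key r hr)

end HolomorphicFunctions

section SquareIntegrals

variable {α : Type*} [MeasurableSpace α] {μ : Measure α}

theorem eLpNorm_two_sq (f : α → ℂ) : eLpNorm f 2 μ ^ 2 = ∫⁻ x, ‖f x‖ₑ ^ 2 ∂μ := by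
  rw [eLpNorm_eq_lintegral_rpow_enorm_toReal two_ne_zero ENNReal.ofNat_ne_top,
    ← ENNReal.rpow_natCast, ← ENNReal.rpow_mul]
  simp

theorem MeasureTheory.MemLp.lintegral_enorm_sq_ne_top {f : α → ℂ} (hf : MemLp f 2 μ) :
    ∫⁻ x, ‖f x‖ₑ ^ 2 ∂μ ≠ ∞ := by
  rw [← eLpNorm_two_sq]
  exact ENNReal.pow_ne_top hf.eLpNorm_ne_top

theorem MeasureTheory.MemLp.toReal_eLpNorm_two_sq {f : α → ℂ} (hf : MemLp f 2 μ) :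
    (eLpNorm f 2 μ).toReal ^ 2 = ∫ x, ‖f x‖ ^ 2 ∂μ := by
  rw [← ENNReal.toReal_pow, eLpNorm_two_sq,
    integral_eq_lintegral_of_nonneg_ae (.of_forall fun _ => by positivity)
      ((continuous_pow 2).comp_aestronglyMeasurable hf.aestronglyMeasurable.norm)]
  congr 2
  ext x
  rw [ENNReal.ofReal_pow (norm_nonneg _), ofReal_norm]

theorem enorm_sub_sq_le (a b : ℂ) : ‖a - b‖ₑ ^ 2 ≤ 2 * ‖a‖ₑ ^ 2 + 2 * ‖b‖ₑ ^ 2 := by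
  simp only [enorm_eq_nnnorm]
  norm_cast
  have h : ‖a - b‖ ≤ ‖a‖ + ‖b‖ := norm_sub_le a b
  have : ‖a - b‖ ^ 2 ≤ 2 * ‖a‖ ^ 2 + 2 * ‖b‖ ^ 2 := by
    nlinarith [norm_nonneg (a - b), sq_nonneg (‖a‖ - ‖b‖)]
  exact_mod_cast this

/-- Almost everywhere convergence together with asymptotic domination of the `L²` norms implies
convergence in `L²`. -/
theorem tendsto_lintegral_enorm_sub_sq {f : ℕ → α → ℂ} {g : α → ℂ} {c : ℕ → ℝ≥0∞}
    (hf : ∀ m, AEStronglyMeasurable (f m) μ) (hg : MemLp g 2 μ)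
    (hlim : ∀ᵐ x ∂μ, Tendsto (fun m => f m x) atTop (𝓝 (g x))) (hc : Tendsto c atTop (𝓝 1))
    (hle : ∀ m, ∫⁻ x, ‖f m x‖ₑ ^ 2 ∂μ ≤ c m * ∫⁻ x, ‖g x‖ₑ ^ 2 ∂μ) :
    Tendsto (fun m => ∫⁻ x, ‖f m x - g x‖ₑ ^ 2 ∂μ) atTop (𝓝 0) := by
  set A := ∫⁻ x, ‖g x‖ₑ ^ 2 ∂μ with hA
  have hAtop : A ≠ ∞ := hg.lintegral_enorm_sq_ne_top
  have hfm : ∀ m, AEMeasurable (fun x => ‖f m x‖ₑ ^ 2) μ := fun m => (hf m).enorm.pow_const 2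
  have hgm : AEMeasurable (fun x => ‖g x‖ₑ ^ 2) μ := hg.aestronglyMeasurable.enorm.pow_const 2
  have hsm : ∀ m, AEMeasurable (fun x => ‖f m x - g x‖ₑ ^ 2) μ := fun m =>
    ((hf m).sub hg.aestronglyMeasurable).enorm.pow_const 2
  set H : ℕ → α → ℝ≥0∞ := fun m x => 2 * ‖f m x‖ₑ ^ 2 + 2 * ‖g x‖ₑ ^ 2 with hH
  have hHm : ∀ m, AEMeasurable (H m) μ := fun m =>
    ((hfm m).const_mul 2).add (hgm.const_mul 2)
  set u : ℕ → ℝ≥0∞ := fun m => ∫⁻ x, (H m x - ‖f m x - g x‖ₑ ^ 2) ∂μ with hu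
  have hsum : ∀ m, ∫⁻ x, ‖f m x - g x‖ₑ ^ 2 ∂μ + u m ≤ 2 * (c m * A) + 2 * A := fun m => by
    rw [hu, ← lintegral_add_left' (hsm m)]
    simp only [add_tsub_cancel_of_le (enorm_sub_sq_le _ _), hH]
    rw [lintegral_add_left' ((hfm m).const_mul 2), lintegral_const_mul'' _ (hfm m),
      lintegral_const_mul'' _ hgm]
    gcongr
    exact hle m
  have hfatou : 4 * A ≤ liminf u atTop := by
    refine le_trans ?_ (lintegral_liminf_le' fun m => (hHm m).sub (hsm m))
    rw [hA, ← lintegral_const_mul'' _ hgm]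
    refine lintegral_mono_ae ?_
    filter_upwards [hlim] with x hx
    have h1 : Tendsto (fun m => ‖f m x‖ₑ ^ 2) atTop (𝓝 (‖g x‖ₑ ^ 2)) :=
      (ENNReal.continuous_pow 2).continuousAt.tendsto.comp hx.enorm
    have h2 : Tendsto (fun m => ‖f m x - g x‖ₑ ^ 2) atTop (𝓝 0) := by
      have h := (ENNReal.continuous_pow 2).continuousAt.tendsto.comp (hx.sub_const (g x)).enorm
      rwa [sub_self, enorm_zero, zero_pow two_ne_zero] at h
    have h3 : Tendsto (fun m => H m x - ‖f m x - g x‖ₑ ^ 2) atTop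
        (𝓝 (2 * ‖g x‖ₑ ^ 2 + 2 * ‖g x‖ₑ ^ 2 - 0)) :=
      ENNReal.Tendsto.sub ((ENNReal.Tendsto.const_mul h1 (.inr (by simp))).add_const _) h2
        (.inr (by simp))
    refine (h3.liminf_eq.trans ?_).ge
    rw [tsub_zero, ← add_mul]
    norm_num
  have h4A : 4 * A ≠ ∞ := ENNReal.mul_ne_top (by simp) hAtop
  have hmin : Tendsto (fun m => min (u m) (4 * A)) atTop (𝓝 (4 * A)) := by
    refine tendsto_order.2 ⟨fun a ha => ?_, fun a ha => .of_forall fun m =>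
      (min_le_right _ _).trans_lt ha⟩
    filter_upwards [eventually_lt_of_lt_liminf (ha.trans_le hfatou)] with m hm
    exact lt_min hm ha
  have hup : Tendsto (fun m => 2 * (c m * A) + 2 * A - min (u m) (4 * A)) atTop (𝓝 0) := by
    have h := ENNReal.Tendsto.sub ((ENNReal.Tendsto.const_mul
      (ENNReal.Tendsto.mul_const hc (.inr hAtop)) (.inr (by simp : (2 : ℝ≥0∞) ≠ ∞))).add_const
        (2 * A)) hmin (.inr h4A)
    have h0 : 2 * (1 * A) + 2 * A - 4 * A = 0 := by
      rw [one_mul, ← add_mul]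
      norm_num
    rwa [h0] at h
  refine tendsto_of_tendsto_of_tendsto_of_le_of_le tendsto_const_nhds hup (fun _ => zero_le)
    fun m => ?_
  refine ENNReal.le_sub_of_add_le_right (ne_top_of_le_ne_top h4A (min_le_right _ _)) ?_
  exact (add_le_add_right (min_le_left _ _) _).trans (hsum m)

end SquareIntegrals

/-- The properties of the measure `v dA` on which the theory of the space `ℋ_{v,n}` rests:
it is finite and carried by the disk, its `L²` norm controls the values of holomorphic functions
on smaller disks, and dilations are bounded with norm at most `r⁻¹`. -/
class IsDiskMeasure (μ : Measure ℂ) : Prop extends IsFiniteMeasure μ where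
  ae_mem : ∀ᵐ z ∂μ, z ∈ ball (0 : ℂ) 1
  bound : ∀ r : ℝ, r < 1 → ∃ C : ℝ≥0∞, C ≠ ∞ ∧ ∀ f : ℂ → ℂ, DifferentiableOn ℂ f (ball 0 1) →
    ∀ z ∈ closedBall (0 : ℂ) r, ‖f z‖ₑ ^ 2 ≤ C * ∫⁻ w, ‖f w‖ₑ ^ 2 ∂μ
  dilation : ∀ r : ℝ, 0 < r → r < 1 → ∀ f : ℂ → ℂ, DifferentiableOn ℂ f (ball 0 1) →
    ∫⁻ z, ‖f (r * z)‖ₑ ^ 2 ∂μ ≤ ENNReal.ofReal (r ^ 2)⁻¹ * ∫⁻ z, ‖f z‖ₑ ^ 2 ∂μ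

section SobolevSpace

variable (μ : Measure ℂ) [IsDiskMeasure μ] (n : ℕ)

theorem DifferentiableOn.contDiffAt_of_mem_ball {f : ℂ → ℂ}
    (hf : DifferentiableOn ℂ f (ball 0 1)) {z : ℂ} (hz : z ∈ ball (0 : ℂ) 1) (k : WithTop ℕ∞) :
    ContDiffAt ℂ k f z :=
  (hf.contDiffOn isOpen_ball).contDiffAt (isOpen_ball.mem_nhds hz)

variable {μ} in
theorem DifferentiableOn.aestronglyMeasurable_iteratedDeriv {f : ℂ → ℂ}
    (hf : DifferentiableOn ℂ f (ball 0 1)) (k : ℕ) :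
    AEStronglyMeasurable (iteratedDeriv k f) μ := by
  have h := (differentiableOn_iteratedDeriv isOpen_ball hf k).continuousOn.aestronglyMeasurable
    (μ := μ) measurableSet_ball
  rwa [Measure.restrict_eq_self_of_ae_mem IsDiskMeasure.ae_mem] at h

variable {μ} in
theorem ae_eq_of_eqOn_ball {f g : ℂ → ℂ} (h : Set.EqOn f g (ball 0 1)) : f =ᵐ[μ] g := by
  filter_upwards [IsDiskMeasure.ae_mem (μ := μ)] with z hz using h hz

variable {μ} in
theorem memLp_iteratedDeriv_of_differentiableOn {f : ℂ → ℂ} {U : Set ℂ} (hU : IsOpen U)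
    (hsub : closedBall (0 : ℂ) 1 ⊆ U) (hf : DifferentiableOn ℂ f U) (k : ℕ) :
    MemLp (iteratedDeriv k f) 2 μ := by
  obtain ⟨C, hC⟩ := (isCompact_closedBall (0 : ℂ) 1).exists_bound_of_continuousOn
    ((differentiableOn_iteratedDeriv hU hf k).continuousOn.mono hsub)
  refine MemLp.of_bound
    ((hf.mono (ball_subset_closedBall.trans hsub)).aestronglyMeasurable_iteratedDeriv k) C ?_
  filter_upwards [IsDiskMeasure.ae_mem (μ := μ)] with z hz using hC z (ball_subset_closedBall hz)

/-- The functions holomorphic on the disk, extended by zero, whose derivatives of order at most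
`n` belong to `L²(μ)`. -/
def sobolevSpace : Submodule ℂ (ℂ → ℂ) where
  carrier := {f | DifferentiableOn ℂ f (ball 0 1) ∧ (∀ z ∉ ball (0 : ℂ) 1, f z = 0) ∧
    ∀ k ≤ n, MemLp (iteratedDeriv k f) 2 μ}
  add_mem' := by
    rintro f g ⟨hf, hf0, hfk⟩ ⟨hg, hg0, hgk⟩
    refine ⟨hf.add hg, fun z hz => by simp [hf0 z hz, hg0 z hz], fun k hk => ?_⟩
    refine ((hfk k hk).add (hgk k hk)).ae_eq (ae_eq_of_eqOn_ball fun z hz => ?_)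
    rw [iteratedDeriv_add (hf.contDiffAt_of_mem_ball hz _) (hg.contDiffAt_of_mem_ball hz _)]
    rfl
  zero_mem' := by
    refine ⟨differentiableOn_const _, fun _ _ => rfl, fun k _ => ?_⟩
    exact memLp_iteratedDeriv_of_differentiableOn isOpen_univ (Set.subset_univ _)
      (differentiableOn_const 0) k
  smul_mem' := by
    rintro c f ⟨hf, hf0, hfk⟩
    refine ⟨hf.const_smul c, fun z hz => by simp [hf0 z hz], fun k hk => ?_⟩
    refine ((hfk k hk).const_smul c).ae_eq (.of_forall fun z => ?_)
    rw [iteratedDeriv_const_smul_field]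
    rfl

variable {μ n} in
theorem indicator_mem_sobolevSpace {f : ℂ → ℂ} (hf : DifferentiableOn ℂ f (ball 0 1))
    (hfk : ∀ k ≤ n, MemLp (iteratedDeriv k f) 2 μ) :
    (ball (0 : ℂ) 1).indicator f ∈ sobolevSpace μ n := by
  have heq : Set.EqOn ((ball (0 : ℂ) 1).indicator f) f (ball 0 1) := Set.eqOn_indicator
  exact ⟨hf.congr heq, fun z hz => Set.indicator_of_notMem hz f, fun k hk =>
    (hfk k hk).ae_eq (ae_eq_of_eqOn_ball (heq.symm.iteratedDeriv_of_isOpen isOpen_ball k))⟩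

/-- The derivatives of order at most `n` of a member of the Sobolev space, as an element of the
Hilbert space `⨁ L²(μ)`. -/
noncomputable def sobolevJet :
    sobolevSpace μ n →ₗ[ℂ] PiLp 2 fun _ : Fin (n + 1) => Lp ℂ 2 μ where
  toFun f := WithLp.toLp 2 fun k => (f.2.2.2 k (Nat.lt_succ_iff.1 k.2)).toLp _
  map_add' f g := by
    ext1 k
    simp only [PiLp.add_apply]
    rw [← MemLp.toLp_add, MemLp.toLp_eq_toLp_iff]
    refine ae_eq_of_eqOn_ball fun z hz => ?_
    exact iteratedDeriv_add (f.2.1.contDiffAt_of_mem_ball hz _) (g.2.1.contDiffAt_of_mem_ball hz _)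
  map_smul' c f := by
    ext1 k
    simp only [PiLp.smul_apply, RingHom.id_apply]
    rw [← MemLp.toLp_const_smul, MemLp.toLp_eq_toLp_iff]
    exact .of_forall fun z => iteratedDeriv_const_smul_field c _

variable {μ n}

theorem memLp_iteratedDeriv_coe (f : sobolevSpace μ n) (k : Fin (n + 1)) :
    MemLp (iteratedDeriv k (f : ℂ → ℂ)) 2 μ :=
  f.2.2.2 k (Nat.lt_succ_iff.1 k.2)

theorem sobolevJet_apply (f : sobolevSpace μ n) (k : Fin (n + 1)) :
    sobolevJet μ n f k = (memLp_iteratedDeriv_coe f k).toLp _ :=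
  rfl

theorem norm_sobolevJet_apply (f : sobolevSpace μ n) (k : Fin (n + 1)) :
    ‖sobolevJet μ n f k‖ = (eLpNorm (iteratedDeriv k (f : ℂ → ℂ)) 2 μ).toReal :=
  Lp.norm_toLp _ (memLp_iteratedDeriv_coe f k)

theorem norm_sobolevJet_sq (f : sobolevSpace μ n) :
    ‖sobolevJet μ n f‖ ^ 2 =
      ∑ k ∈ Finset.range (n + 1), ∫ z, ‖iteratedDeriv k (f : ℂ → ℂ) z‖ ^ 2 ∂μ := by
  rw [PiLp.norm_sq_eq_of_L2, Finset.sum_range]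
  refine Finset.sum_congr rfl fun k _ => ?_
  rw [norm_sobolevJet_apply, (memLp_iteratedDeriv_coe f k).toReal_eLpNorm_two_sq]

theorem norm_sobolevJet_le {f : sobolevSpace μ n} {ε : ℝ} (hε : 0 ≤ ε)
    (h : ∀ k ≤ n, ∫⁻ z, ‖iteratedDeriv k (f : ℂ → ℂ) z‖ₑ ^ 2 ∂μ ≤ ENNReal.ofReal (ε ^ 2)) :
    ‖sobolevJet μ n f‖ ≤ (n + 1) * ε := by
  rw [← sq_le_sq₀ (norm_nonneg _) (by positivity), PiLp.norm_sq_eq_of_L2]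
  calc _ ≤ ∑ _k : Fin (n + 1), ε ^ 2 := Finset.sum_le_sum fun k _ => ?_
    _ ≤ _ := ?_
  · rw [norm_sobolevJet_apply, ← ENNReal.toReal_pow, eLpNorm_two_sq]
    exact ENNReal.toReal_le_of_le_ofReal (by positivity) (h k (Nat.lt_succ_iff.1 k.2))
  · simp only [Finset.sum_const, Finset.card_univ, Fintype.card_fin, nsmul_eq_mul, Nat.cast_add,
      Nat.cast_one, mul_pow]
    gcongr
    nlinarith [(Nat.cast_nonneg n : (0 : ℝ) ≤ n)]

theorem exists_norm_le_mul_norm_sobolevJet (μ : Measure ℂ) [IsDiskMeasure μ] (n : ℕ) {r : ℝ}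
    (hr : r < 1) : ∃ C : ℝ, 0 ≤ C ∧ ∀ f : sobolevSpace μ n, ∀ z ∈ closedBall (0 : ℂ) r,
      ‖(f : ℂ → ℂ) z‖ ≤ C * ‖sobolevJet μ n f‖ := by
  obtain ⟨C, hC, h⟩ := IsDiskMeasure.bound (μ := μ) r hr
  refine ⟨√C.toReal, Real.sqrt_nonneg _, fun f z hz => ?_⟩
  have hf : MemLp (f : ℂ → ℂ) 2 μ := by simpa using f.2.2.2 0 (Nat.zero_le n)
  have h1 := ENNReal.toReal_mono (ENNReal.mul_ne_top hC hf.lintegral_enorm_sq_ne_top)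
    (h f f.2.1 z hz)
  rw [← eLpNorm_two_sq, ENNReal.toReal_mul, ENNReal.toReal_pow, ENNReal.toReal_pow,
    toReal_enorm] at h1
  have h2 : (eLpNorm (f : ℂ → ℂ) 2 μ).toReal ≤ ‖sobolevJet μ n f‖ := by
    have := norm_sobolevJet_apply f 0
    simp only [Fin.val_zero, iteratedDeriv_zero] at this
    rw [← this]
    exact PiLp.norm_apply_le _ _
  rw [← sq_le_sq₀ (norm_nonneg _) (by positivity), mul_pow, Real.sq_sqrt ENNReal.toReal_nonneg]
  refine h1.trans ?_
  gcongr

theorem sobolevJet_injective : Function.Injective (sobolevJet μ n) := by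
  rw [injective_iff_map_eq_zero]
  intro f hf
  ext z
  by_cases hz : z ∈ ball (0 : ℂ) 1
  · obtain ⟨C, -, hC⟩ := exists_norm_le_mul_norm_sobolevJet μ n (mem_ball_zero_iff.1 hz)
    simpa [hf] using hC f z (by simp)
  · exact f.2.2.1 z hz

/-- Cauchy sequences of jets come from locally uniformly convergent sequences. -/
theorem isClosed_range_sobolevJet :
    IsClosed (LinearMap.range (sobolevJet μ n) :
      Set (PiLp 2 fun _ : Fin (n + 1) => Lp ℂ 2 μ)) := by
  refine IsSeqClosed.isClosed fun u g hu hg => ?_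
  choose F hF using hu
  have hcauchy : CauchySeq fun m => sobolevJet μ n (F m) := by simpa only [hF] using hg.cauchySeq
  have hunif : ∀ r < 1, UniformCauchySeqOn (fun m => (F m : ℂ → ℂ)) atTop (closedBall 0 r) := by
    intro r hr
    obtain ⟨C, hC0, hC⟩ := exists_norm_le_mul_norm_sobolevJet μ n hr
    rw [Metric.uniformCauchySeqOn_iff]
    intro ε hε
    obtain ⟨N, hN⟩ := Metric.cauchySeq_iff.1 hcauchy (ε / (C + 1)) (by positivity)
    refine ⟨N, fun m hm l hl z hz => ?_⟩
    have h1 := hC (F m - F l) z hz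
    have h2 := hN m hm l hl
    rw [dist_eq_norm, ← map_sub, lt_div_iff₀ (by positivity)] at h2
    rw [dist_eq_norm]
    refine lt_of_le_of_lt h1 (lt_of_le_of_lt ?_ h2)
    nlinarith [norm_nonneg (sobolevJet μ n (F m - F l))]
  have hpt : ∀ z, ∃ w, z ∈ ball (0 : ℂ) 1 → Tendsto (fun m => (F m : ℂ → ℂ) z) atTop (𝓝 w) := by
    intro z
    by_cases hz : z ∈ ball (0 : ℂ) 1
    · obtain ⟨w, hw⟩ := cauchySeq_tendsto_of_complete
        ((hunif ‖z‖ (mem_ball_zero_iff.1 hz)).cauchySeq (x := z) (by simp))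
      exact ⟨w, fun _ => hw⟩
    · exact ⟨0, fun h => absurd h hz⟩
  choose f hf using hpt
  have hloc : TendstoLocallyUniformlyOn (fun m => (F m : ℂ → ℂ)) f atTop (ball 0 1) := by
    rw [tendstoLocallyUniformlyOn_iff_forall_isCompact isOpen_ball]
    intro K hK hKc
    obtain ⟨r, hr, hKr⟩ := exists_lt_subset_ball hKc.isClosed hK
    exact ((hunif r hr).tendstoUniformlyOn_of_tendsto fun z hz =>
      hf z (closedBall_subset_ball hr hz)).mono (hKr.trans ball_subset_closedBall)
  have hfd : DifferentiableOn ℂ f (ball 0 1) :=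
    hloc.differentiableOn (.of_forall fun m => (F m).2.1) isOpen_ball
  have hae : ∀ k : Fin (n + 1), g k =ᵐ[μ] iteratedDeriv k f := by
    intro k
    have hk : Tendsto (fun m => u m k) atTop (𝓝 (g k)) :=
      ((PiLp.continuous_apply 2 _ k).tendsto g).comp hg
    obtain ⟨s, hs, hlim⟩ := (tendstoInMeasure_of_tendsto_Lp hk).exists_seq_tendsto_ae
    have huk : ∀ m, u m k =ᵐ[μ] iteratedDeriv k (F m : ℂ → ℂ) := fun m => by
      rw [← hF m, sobolevJet_apply]
      exact MemLp.coeFn_toLp _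
    filter_upwards [hlim, ae_all_iff.2 huk, IsDiskMeasure.ae_mem (μ := μ)] with z h1 h2 hz
    simp only [h2] at h1
    exact tendsto_nhds_unique h1 (((hloc.iteratedDeriv_of_isOpen (fun m => (F m).2.1) isOpen_ball
      k).tendsto_at hz).comp hs.tendsto_atTop)
  have hmem := indicator_mem_sobolevSpace (μ := μ) (n := n) hfd fun k hk =>
    (Lp.memLp (g ⟨k, Nat.lt_succ_iff.2 hk⟩)).ae_eq (hae ⟨k, Nat.lt_succ_iff.2 hk⟩)
  refine ⟨⟨_, hmem⟩, ?_⟩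
  refine PiLp.ext fun k => ?_
  rw [sobolevJet_apply]
  refine Lp.ext ((MemLp.coeFn_toLp _).trans (EventuallyEq.trans ?_ (hae k).symm))
  exact ae_eq_of_eqOn_ball (Set.eqOn_indicator.iteratedDeriv_of_isOpen isOpen_ball k)

end SobolevSpace

section DiskSpace

variable (μ : Measure ℂ) [IsDiskMeasure μ] (n : ℕ)

/-- Polynomials as members of the Sobolev space. -/
noncomputable def sobolevPoly : Polynomial ℂ →ₗ[ℂ] sobolevSpace μ n where
  toFun p := ⟨_, indicator_mem_sobolevSpace (f := fun z => p.eval z)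
    p.differentiable.differentiableOn fun k _ => memLp_iteratedDeriv_of_differentiableOn
      isOpen_univ (Set.subset_univ _) p.differentiable.differentiableOn k⟩
  map_add' p q := by
    ext z
    by_cases hz : z ∈ ball (0 : ℂ) 1 <;> simp [Set.indicator, hz]
  map_smul' c p := by
    ext z
    by_cases hz : z ∈ ball (0 : ℂ) 1 <;> simp [Set.indicator, hz]

theorem sobolevPoly_eqOn (p : Polynomial ℂ) :
    Set.EqOn (sobolevPoly μ n p : ℂ → ℂ) (fun z => p.eval z) (ball 0 1) :=
  Set.eqOn_indicator

variable {μ} in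
theorem MeasureTheory.MemLp.iteratedDeriv_id_mul {f : ℂ → ℂ}
    (hf : DifferentiableOn ℂ f (ball 0 1)) {k : ℕ}
    (hfk : ∀ j ≤ k, MemLp (iteratedDeriv j f) 2 μ) :
    MemLp (iteratedDeriv k (id * f)) 2 μ := by
  have hsum : MemLp (fun z => ∑ i ∈ Finset.range (k + 1),
      (k.choose i : ℂ) * iteratedDeriv i id z * iteratedDeriv (k - i) f z) 2 μ := by
    refine memLp_finsetSum _ fun i _ => ?_
    have hid : ContinuousOn (fun z => (k.choose i : ℂ) * iteratedDeriv i id z)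
        (closedBall (0 : ℂ) 1) :=
      continuousOn_const.mul ((differentiableOn_iteratedDeriv isOpen_univ
        differentiableOn_id i).continuousOn.mono (Set.subset_univ _))
    obtain ⟨C, hC⟩ := (isCompact_closedBall (0 : ℂ) 1).exists_bound_of_continuousOn hid
    refine (hfk (k - i) (Nat.sub_le _ _)).of_le_mul (c := C) ?_ ?_
    · exact (aestronglyMeasurable_const.mul
        (differentiableOn_id.aestronglyMeasurable_iteratedDeriv i)).mul
          (hf.aestronglyMeasurable_iteratedDeriv _)
    · filter_upwards [IsDiskMeasure.ae_mem (μ := μ)] with z hz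
      rw [norm_mul]
      gcongr
      exact hC z (ball_subset_closedBall hz)
  refine hsum.ae_eq (ae_eq_of_eqOn_ball fun z hz => ?_)
  exact (iteratedDeriv_mul contDiffAt_id (hf.contDiffAt_of_mem_ball hz _)).symm

/-- Multiplication by the independent variable on the Sobolev space. -/
noncomputable def sobolevShift : sobolevSpace μ n →ₗ[ℂ] sobolevSpace μ n where
  toFun f := ⟨id * (f : ℂ → ℂ), differentiableOn_id.mul f.2.1, fun z hz => by simp [f.2.2.1 z hz],
    fun _ hk => MemLp.iteratedDeriv_id_mul f.2.1 fun j hj => f.2.2.2 j (hj.trans hk)⟩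
  map_add' f g := by ext z; simp [mul_add]
  map_smul' c f := by ext z; simp [mul_left_comm]

variable {μ} in
/-- Dilations converge in `L²`, together with all derivatives. -/
theorem tendsto_lintegral_dilation {f : ℂ → ℂ} (hf : DifferentiableOn ℂ f (ball 0 1)) {k : ℕ}
    (hfk : MemLp (iteratedDeriv k f) 2 μ) {r : ℕ → ℝ} (hr : ∀ m, r m ∈ Set.Ioo 0 1)
    (hlim : Tendsto r atTop (𝓝 1)) :
    Tendsto (fun m => ∫⁻ z, ‖(r m : ℂ) ^ k * iteratedDeriv k f (r m * z) -
      iteratedDeriv k f z‖ₑ ^ 2 ∂μ) atTop (𝓝 0) := by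
  have hd := differentiableOn_iteratedDeriv isOpen_ball hf k
  have hmaps : ∀ m, Set.MapsTo (fun z : ℂ => r m * z) (ball 0 1) (ball 0 1) := fun m z hz => by
    rw [mem_ball_zero_iff] at hz ⊢
    rw [norm_mul, Complex.norm_real, Real.norm_of_nonneg (hr m).1.le]
    nlinarith [(hr m).1, (hr m).2, norm_nonneg z]
  have hlimC : Tendsto (fun m => (r m : ℂ)) atTop (𝓝 1) := by
    have h := (Complex.continuous_ofReal.tendsto 1).comp hlim
    rwa [Complex.ofReal_one] at h
  refine tendsto_lintegral_enorm_sub_sq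
    (c := fun m => ENNReal.ofReal ((r m) ^ k) ^ 2 * ENNReal.ofReal ((r m) ^ 2)⁻¹)
    (fun m => ?_) hfk ?_ ?_ fun m => ?_
  · have h : DifferentiableOn ℂ (fun z : ℂ => (r m : ℂ) ^ k * iteratedDeriv k f (r m * z))
        (ball 0 1) :=
      (hd.comp (by fun_prop) (hmaps m)).const_mul _
    simpa using h.aestronglyMeasurable_iteratedDeriv (μ := μ) 0
  · filter_upwards [IsDiskMeasure.ae_mem (μ := μ)] with z hz
    have h1 : Tendsto (fun m => (r m : ℂ) * z) atTop (𝓝 z) := by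
      simpa using hlimC.mul_const z
    simpa using (hlimC.pow k).mul
      (((hd.continuousOn.continuousAt (isOpen_ball.mem_nhds hz)).tendsto).comp h1)
  · have h : Tendsto (fun m => ENNReal.ofReal (((r m) ^ k) ^ 2 * ((r m) ^ 2)⁻¹)) atTop
        (𝓝 (ENNReal.ofReal ((1 ^ k) ^ 2 * (1 ^ 2)⁻¹))) :=
      ENNReal.tendsto_ofReal (((hlim.pow k).pow 2).mul ((hlim.pow 2).inv₀ (by norm_num)))
    simp only [one_pow, inv_one, mul_one, ENNReal.ofReal_one] at h
    refine h.congr fun m => ?_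
    have := (hr m).1
    rw [ENNReal.ofReal_mul (by positivity), ENNReal.ofReal_pow (by positivity)]
  · simp only [enorm_mul, mul_pow]
    rw [lintegral_const_mul' _ _ (by simp), mul_assoc]
    refine mul_le_mul' (le_of_eq ?_) (IsDiskMeasure.dilation (r m) (hr m).1 (hr m).2 _ hd)
    rw [enorm_pow, ← ofReal_norm, Complex.norm_real, Real.norm_of_nonneg (hr m).1.le,
      ENNReal.ofReal_pow (hr m).1.le]

variable {μ} in
/-- Dilations are approximated by polynomials. -/
theorem exists_polynomial_lintegral_dilation_le {f : ℂ → ℂ}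
    (hf : DifferentiableOn ℂ f (ball 0 1)) {r : ℝ} (hr : 0 < r) (hr1 : r < 1) {ε : ℝ}
    (hε : 0 < ε) : ∃ p : Polynomial ℂ, ∀ k ≤ n,
      ∫⁻ z, ‖iteratedDeriv k (fun z => p.eval z) z - (r : ℂ) ^ k * iteratedDeriv k f (r * z)‖ₑ ^ 2
        ∂μ ≤ ENNReal.ofReal (ε ^ 2) := by
  obtain ⟨p, hp⟩ := exists_polynomial_tendstoUniformlyOn hf hr hr1
  set M := (μ Set.univ).toReal with hM
  have hM0 : 0 ≤ M := ENNReal.toReal_nonneg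
  have hη : 0 < ε / (M + 1) := by positivity
  have hev : ∀ᶠ N in atTop, ∀ k ∈ Finset.range (n + 1), ∀ z ∈ closedBall (0 : ℂ) r,
      dist (iteratedDeriv k f z) (iteratedDeriv k (fun z => (p N).eval z) z) < ε / (M + 1) :=
    (Finset.eventually_all _).2 fun k _ => Metric.tendstoUniformlyOn_iff.1 (hp k) _ hη
  obtain ⟨N, hN⟩ := hev.exists
  refine ⟨(p N).comp (Polynomial.C (r : ℂ) * Polynomial.X), fun k hk => ?_⟩
  simp only [Polynomial.eval_comp, Polynomial.eval_mul, Polynomial.eval_C, Polynomial.eval_X]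
  rw [iteratedDeriv_comp_mul_left (fun z => (p N).eval z)]
  calc _ ≤ ∫⁻ _, ENNReal.ofReal ((ε / (M + 1)) ^ 2) ∂μ := lintegral_mono_ae ?_
    _ = ENNReal.ofReal ((ε / (M + 1)) ^ 2 * M) := by
      rw [lintegral_const, ENNReal.ofReal_mul (by positivity), hM,
        ENNReal.ofReal_toReal (measure_ne_top _ _)]
    _ ≤ _ := ENNReal.ofReal_le_ofReal ?_
  · filter_upwards [IsDiskMeasure.ae_mem (μ := μ)] with z hz
    have hz' := (mem_ball_zero_iff.1 hz).le
    have hrz : (r : ℂ) * z ∈ closedBall (0 : ℂ) r := by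
      rw [mem_closedBall_zero_iff, norm_mul, Complex.norm_real, Real.norm_of_nonneg hr.le]
      exact mul_le_of_le_one_right hr.le hz'
    have h := (hN k (Finset.mem_range.2 (Nat.lt_succ_iff.2 hk)) _ hrz).le
    rw [dist_comm, dist_eq_norm] at h
    rw [← mul_sub, ← ofReal_norm, ENNReal.ofReal_pow (by positivity)]
    gcongr
    rw [norm_mul, norm_pow, Complex.norm_real, Real.norm_of_nonneg hr.le]
    exact (mul_le_of_le_one_left (norm_nonneg _) (pow_le_one₀ hr.le hr1.le)).trans h
  · rw [div_pow, div_mul_eq_mul_div, div_le_iff₀ (by positivity)]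
    gcongr
    nlinarith

theorem exists_norm_sobolevJet_sobolevPoly_sub_lt (f : sobolevSpace μ n) {ε : ℝ} (hε : 0 < ε) :
    ∃ p : Polynomial ℂ, ‖sobolevJet μ n (sobolevPoly μ n p - f)‖ < ε := by
  set δ := ε / (2 * (n + 2)) with hδ
  have hδ0 : 0 < δ := by positivity
  obtain ⟨r, -, hr, hlim⟩ := exists_seq_strictMono_tendsto' (zero_lt_one' ℝ)
  have hev : ∀ᶠ m in atTop, ∀ k ∈ Finset.range (n + 1), ∫⁻ z, ‖(r m : ℂ) ^ k *
      iteratedDeriv k (f : ℂ → ℂ) (r m * z) - iteratedDeriv k (f : ℂ → ℂ) z‖ₑ ^ 2 ∂μ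
        ≤ ENNReal.ofReal (δ ^ 2) := by
    refine (Finset.eventually_all _).2 fun k hk => ?_
    exact ENNReal.tendsto_nhds_zero.1 (tendsto_lintegral_dilation f.2.1
      (f.2.2.2 k (Nat.lt_succ_iff.1 (Finset.mem_range.1 hk))) hr hlim) _ (by positivity)
  obtain ⟨m, hm⟩ := hev.exists
  obtain ⟨p, hp⟩ := exists_polynomial_lintegral_dilation_le (μ := μ) n f.2.1 (hr m).1 (hr m).2 hδ0
  refine ⟨p, ?_⟩
  have hle : ‖sobolevJet μ n (sobolevPoly μ n p - f)‖ ≤ (n + 1) * (2 * δ) := by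
    refine norm_sobolevJet_le (by positivity) fun k hk => ?_
    have hpm : AEMeasurable (fun z => ‖iteratedDeriv k (fun z => p.eval z) z -
        (r m : ℂ) ^ k * iteratedDeriv k (f : ℂ → ℂ) (r m * z)‖ₑ ^ 2) μ := by
      have hd : DifferentiableOn ℂ (fun z => iteratedDeriv k (fun z => p.eval z) z -
          iteratedDeriv k (fun z => (f : ℂ → ℂ) (r m * z)) z) (ball 0 1) := by
        refine (differentiableOn_iteratedDeriv isOpen_ball p.differentiable.differentiableOn k).sub
          (differentiableOn_iteratedDeriv isOpen_ball (f.2.1.comp (by fun_prop) fun z hz => ?_) k)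
        rw [mem_ball_zero_iff] at hz ⊢
        rw [norm_mul, Complex.norm_real, Real.norm_of_nonneg (hr m).1.le]
        nlinarith [(hr m).1, (hr m).2, norm_nonneg z]
      have := hd.aestronglyMeasurable_iteratedDeriv (μ := μ) 0
      rw [iteratedDeriv_comp_mul_left, iteratedDeriv_zero] at this
      exact this.enorm.pow_const 2
    calc _ ≤ ∫⁻ z, (2 * ‖iteratedDeriv k (fun z => p.eval z) z -
            (r m : ℂ) ^ k * iteratedDeriv k (f : ℂ → ℂ) (r m * z)‖ₑ ^ 2 +
          2 * ‖(r m : ℂ) ^ k * iteratedDeriv k (f : ℂ → ℂ) (r m * z) -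
            iteratedDeriv k (f : ℂ → ℂ) z‖ₑ ^ 2) ∂μ := lintegral_mono_ae ?_
      _ ≤ 2 * ENNReal.ofReal (δ ^ 2) + 2 * ENNReal.ofReal (δ ^ 2) := ?_
      _ = ENNReal.ofReal ((2 * δ) ^ 2) := ?_
    · filter_upwards [IsDiskMeasure.ae_mem (μ := μ)] with z hz
      have hsub : iteratedDeriv k ((sobolevPoly μ n p - f : sobolevSpace μ n) : ℂ → ℂ) z =
          iteratedDeriv k (fun z => p.eval z) z - iteratedDeriv k (f : ℂ → ℂ) z := by
        rw [Submodule.coe_sub, iteratedDeriv_sub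
          ((sobolevPoly μ n p).2.1.contDiffAt_of_mem_ball hz _) (f.2.1.contDiffAt_of_mem_ball hz _),
          (sobolevPoly_eqOn μ n p).iteratedDeriv_of_isOpen isOpen_ball k hz]
      rw [hsub]
      have h := enorm_sub_sq_le (iteratedDeriv k (fun z => p.eval z) z -
            (r m : ℂ) ^ k * iteratedDeriv k (f : ℂ → ℂ) (r m * z))
          (iteratedDeriv k (f : ℂ → ℂ) z -
            (r m : ℂ) ^ k * iteratedDeriv k (f : ℂ → ℂ) (r m * z))
      rwa [sub_sub_sub_cancel_right, enorm_sub_rev (iteratedDeriv k (f : ℂ → ℂ) z)] at h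
    · rw [lintegral_add_left' (hpm.const_mul 2), lintegral_const_mul' _ _ (by simp),
        lintegral_const_mul' _ _ (by simp)]
      gcongr
      · exact hp k hk
      · exact hm k (Finset.mem_range.2 (Nat.lt_succ_iff.2 hk))
    · rw [← add_mul, mul_pow, ENNReal.ofReal_mul (by positivity)]
      norm_num
  refine hle.trans_lt ?_
  rw [hδ, mul_div_assoc', mul_div_assoc', div_lt_iff₀ (by positivity)]
  nlinarith

/-- The Sobolev space is isomorphic to the space of its jets. -/
noncomputable def sobolevEquiv :
    sobolevSpace μ n ≃ₗ[ℂ] LinearMap.range (sobolevJet μ n) :=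
  LinearEquiv.ofInjective _ sobolevJet_injective

theorem norm_sobolevEquiv (f : sobolevSpace μ n) :
    ‖sobolevEquiv μ n f‖ = ‖sobolevJet μ n f‖ :=
  rfl

theorem continuous_sobolevEquiv_symm_apply {z : ℂ} (hz : z ∈ ball (0 : ℂ) 1) :
    Continuous fun F => ((sobolevEquiv μ n).symm F : ℂ → ℂ) z := by
  obtain ⟨C, -, hC⟩ := exists_norm_le_mul_norm_sobolevJet μ n (mem_ball_zero_iff.1 hz)
  let L : LinearMap.range (sobolevJet μ n) →ₗ[ℂ] ℂ :=
    LinearMap.proj z ∘ₗ (sobolevSpace μ n).subtype ∘ₗ (sobolevEquiv μ n).symm.toLinearMap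
  refine AddMonoidHomClass.continuous_of_bound L C fun F => ?_
  have h := hC ((sobolevEquiv μ n).symm F) z (by simp)
  rwa [← norm_sobolevEquiv, LinearEquiv.apply_symm_apply] at h

instance : CompleteSpace (LinearMap.range (sobolevJet μ n)) :=
  isClosed_range_sobolevJet.completeSpace_coe

theorem continuous_sobolevShift : Continuous
    ((sobolevEquiv μ n).toLinearMap ∘ₗ sobolevShift μ n ∘ₗ
      (sobolevEquiv μ n).symm.toLinearMap) := by
  refine LinearMap.continuous_of_seq_closed_graph _ fun u F G hu hSu => ?_
  refine (sobolevEquiv μ n).symm.injective (Subtype.ext (funext fun z => ?_))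
  by_cases hz : z ∈ ball (0 : ℂ) 1
  · have h1 := ((continuous_sobolevEquiv_symm_apply μ n hz).tendsto F).comp hu
    have h2 := ((continuous_sobolevEquiv_symm_apply μ n hz).tendsto G).comp hSu
    refine tendsto_nhds_unique h2 ?_
    simpa [Function.comp_def, sobolevShift] using h1.const_mul z
  · exact (((sobolevEquiv μ n).symm G).2.2.1 z hz).trans
      (((sobolevEquiv μ n).symm _).2.2.1 z hz).symm

/-- The Hilbert space `ℋ_{v,n}` with `μ = v dA`. -/
noncomputable def sobolevDiskSpace : DiskHilbertSpace where
  carrier := LinearMap.range (sobolevJet μ n)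
  toFun := (sobolevSpace μ n).subtype ∘ₗ (sobolevEquiv μ n).symm.toLinearMap
  holo F := ((sobolevEquiv μ n).symm F).2.1
  inj F G h := by
    refine (sobolevEquiv μ n).symm.injective (Subtype.ext (funext fun z => ?_))
    by_cases hz : z ∈ ball (0 : ℂ) 1
    · exact h hz
    · exact (((sobolevEquiv μ n).symm F).2.2.1 z hz).trans
        (((sobolevEquiv μ n).symm G).2.2.1 z hz).symm
  poly := (sobolevEquiv μ n).toLinearMap ∘ₗ sobolevPoly μ n
  poly_eval p z hz := by
    simpa using sobolevPoly_eqOn μ n p hz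
  dense_poly := by
    rw [Metric.dense_iff]
    intro F ε hε
    obtain ⟨p, hp⟩ :=
      exists_norm_sobolevJet_sobolevPoly_sub_lt μ n ((sobolevEquiv μ n).symm F) hε
    refine ⟨_, ?_, p, rfl⟩
    rwa [← norm_sobolevEquiv, map_sub, LinearEquiv.apply_symm_apply, ← dist_eq_norm] at hp
  eval_cont z hz := continuous_sobolevEquiv_symm_apply μ n hz
  shift := ⟨_, continuous_sobolevShift μ n⟩
  shift_eval F z _ := by
    simp [sobolevShift]

theorem sobolevDiskSpace_exists_toFun_eqOn {f : ℂ → ℂ} (hf : DifferentiableOn ℂ f (ball 0 1))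
    (hfk : ∀ k ≤ n, MemLp (iteratedDeriv k f) 2 μ) :
    ∃ F : (sobolevDiskSpace μ n).carrier,
      Set.EqOn ((sobolevDiskSpace μ n).toFun F) f (ball 0 1) := by
  refine ⟨sobolevEquiv μ n ⟨_, indicator_mem_sobolevSpace hf hfk⟩, fun z hz => ?_⟩
  change ((sobolevEquiv μ n).symm (sobolevEquiv μ n ⟨_, _⟩) : ℂ → ℂ) z = f z
  rw [LinearEquiv.symm_apply_apply]
  exact Set.indicator_of_mem hz f

theorem norm_sobolevDiskSpace_sq (F : LinearMap.range (sobolevJet μ n)) : ‖F‖ ^ 2 =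
    ∑ k ∈ Finset.range (n + 1),
      ∫ z, ‖iteratedDeriv k ((sobolevEquiv μ n).symm F : ℂ → ℂ) z‖ ^ 2 ∂μ := by
  rw [← norm_sobolevJet_sq, ← norm_sobolevEquiv, LinearEquiv.apply_symm_apply]

end DiskSpace

/-- If the functions `(z - w)⁻¹` with `|w| > 1` belong to the space, then evaluations at points
outside the closed disk are unbounded. -/
theorem DiskHilbertSpace.maxDomain_subset_closedBall (H : DiskHilbertSpace)
    (h : ∀ w ∉ closedBall (0 : ℂ) 1, ∃ F : H.carrier,
      Set.EqOn (H.toFun F) (fun z => (z - w)⁻¹) (ball 0 1)) :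
    H.maxDomain ⊆ closedBall (0 : ℂ) 1 := by
  rintro w ⟨Λ, hΛ⟩
  by_contra hw
  obtain ⟨F, hF⟩ := h w hw
  have hshift : ∀ p, H.shift (H.poly p) = H.poly (Polynomial.X * p) := fun p =>
    H.inj _ _ fun z hz => by
      rw [H.shift_eval _ z hz, H.poly_eval _ z hz, H.poly_eval _ z hz]
      simp
  have hker : (fun G => Λ (H.shift G - w • G)) = fun _ => 0 :=
    Continuous.ext_on H.dense_poly (by fun_prop) continuous_const (by
      rintro _ ⟨p, rfl⟩
      simp [hshift, hΛ])
  have hone : H.shift F - w • F = H.poly 1 := H.inj _ _ fun z hz => by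
    have hzw : z - w ≠ 0 := fun h0 => hw (by
      rw [← sub_eq_zero.1 h0]
      exact ball_subset_closedBall hz)
    rw [map_sub, map_smul, Pi.sub_apply, Pi.smul_apply, H.shift_eval _ z hz, hF hz,
      H.poly_eval _ z hz, smul_eq_mul, ← sub_mul, mul_inv_cancel₀ hzw, Polynomial.eval_one]
  have h1 := congrFun hker F
  simp [hone, hΛ] at h1

theorem sobolevDiskSpace_maxDomain_subset (μ : Measure ℂ) [IsDiskMeasure μ] (n : ℕ) :
    (sobolevDiskSpace μ n).maxDomain ⊆ closedBall (0 : ℂ) 1 := by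
  refine DiskHilbertSpace.maxDomain_subset_closedBall _ fun w hw => ?_
  have hd : DifferentiableOn ℂ (fun z => (z - w)⁻¹) {w}ᶜ := fun z hz =>
    ((differentiableAt_id.sub_const w).inv (sub_ne_zero.2 hz)).differentiableWithinAt
  have hsub : closedBall (0 : ℂ) 1 ⊆ {w}ᶜ := fun z hz h => hw (h ▸ hz)
  exact sobolevDiskSpace_exists_toFun_eqOn μ n (hd.mono (ball_subset_closedBall.trans hsub))
    fun k _ => memLp_iteratedDeriv_of_differentiableOn isOpen_compl_singleton hsub hd k

instance : dA.IsAddHaarMeasure :=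
  .smul volume (by simp) (by simp [Real.pi_pos])

theorem lintegral_dA_comp_mul_left {r : ℝ} (hr : 0 < r) (g : ℂ → ℝ≥0∞) :
    ∫⁻ z, g (r * z) ∂dA = ENNReal.ofReal (r ^ 2)⁻¹ * ∫⁻ z, g z ∂dA := by
  have h := lintegral_map_equiv (μ := dA) g (Homeomorph.smulOfNeZero r hr.ne').toMeasurableEquiv
  have hmap := Measure.map_addHaar_smul dA hr.ne'
  rw [Complex.finrank_real_complex, abs_of_pos (by positivity)] at hmap
  change ∫⁻ z, g z ∂(Measure.map (r • ·) dA) = ∫⁻ z, g (r • z) ∂dA at h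
  rw [hmap, lintegral_smul_measure] at h
  simpa only [Complex.real_smul, smul_eq_mul] using h.symm

theorem setLIntegral_volume_eq_dA (s : Set ℂ) (g : ℂ → ℝ≥0∞) :
    ∫⁻ z in s, g z = ENNReal.ofReal Real.pi * ∫⁻ z in s, g z ∂dA := by
  rw [dA, Measure.restrict_smul, lintegral_smul_measure, smul_eq_mul, ← mul_assoc,
    ENNReal.mul_inv_cancel (by simp [Real.pi_pos]) (by simp), one_mul]

theorem setLIntegral_Ioo_ofReal_ne_zero {ρ : ℝ} (hρ : 0 < ρ) :
    ∫⁻ r in Set.Ioo 0 ρ, ENNReal.ofReal r ≠ 0 := by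
  rw [Ne, lintegral_eq_zero_iff (by fun_prop), Filter.EventuallyEq,
    ae_restrict_iff' measurableSet_Ioo]
  intro h
  have h0 : volume (Set.Ioo 0 ρ) = 0 := measure_mono_null (fun r hr => by
    simpa using ⟨hr.1, hr.2, hr.1⟩) h
  simp [hρ.not_ge] at h0

theorem setLIntegral_Ioo_ofReal_ne_top (ρ : ℝ) :
    ∫⁻ r in Set.Ioo 0 ρ, ENNReal.ofReal r ≠ ∞ := by
  refine (lt_of_le_of_lt (setLIntegral_mono (g := fun _ => ENNReal.ofReal ρ) measurable_const
    fun r hr => ENNReal.ofReal_le_ofReal hr.2.le) ?_).ne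
  simpa using ENNReal.mul_lt_top (by simp) (by simp)

/-- The measure `v dA` on the disk. -/
noncomputable def weightMeasure (v : ℂ → ℝ) : Measure ℂ :=
  (dA.restrict (ball 0 1)).withDensity fun z => ENNReal.ofReal (v z)

section WeightMeasure

variable {v : ℂ → ℝ}

theorem lintegral_weightMeasure (hv : IntegrableOn v (ball (0 : ℂ) 1) dA) (g : ℂ → ℝ≥0∞) :
    ∫⁻ z, g z ∂(weightMeasure v) = ∫⁻ z in ball 0 1, ENNReal.ofReal (v z) * g z ∂dA :=
  lintegral_withDensity_eq_lintegral_mul_non_measurable₀ _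
    hv.aestronglyMeasurable.aemeasurable.ennreal_ofReal (.of_forall fun _ => by simp) g

theorem ae_pos_of_ae_lt_on_balls
    (hpos : ∀ r : ℝ, r < 1 → ∃ δ > 0, ∀ᵐ z ∂(dA.restrict (ball (0 : ℂ) r)), δ < v z) :
    ∀ᵐ z ∂(dA.restrict (ball (0 : ℂ) 1)), 0 < v z := by
  obtain ⟨r, -, hr, hlim⟩ := exists_seq_strictMono_tendsto (1 : ℝ)
  have hsub : ball (0 : ℂ) 1 ⊆ ⋃ m, ball 0 (r m) := fun z hz =>
    Set.mem_iUnion.2 ((hlim.eventually (lt_mem_nhds (mem_ball_zero_iff.1 hz))).exists.imp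
      fun m hm => mem_ball_zero_iff.2 hm)
  refine ae_restrict_of_ae_restrict_of_subset hsub ((ae_restrict_iUnion_iff _ _).2 fun m => ?_)
  obtain ⟨δ, hδ, h⟩ := hpos (r m) (hr m)
  filter_upwards [h] with z hz using hδ.trans hz

theorem enorm_sq_le_mul_lintegral_weightMeasure (hv : IntegrableOn v (ball (0 : ℂ) 1) dA)
    (hpos : ∀ r : ℝ, r < 1 → ∃ δ > 0, ∀ᵐ z ∂(dA.restrict (ball (0 : ℂ) r)), δ < v z)
    {r : ℝ} (hr : r < 1) : ∃ C : ℝ≥0∞, C ≠ ∞ ∧ ∀ f : ℂ → ℂ, DifferentiableOn ℂ f (ball 0 1) →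
      ∀ z ∈ closedBall (0 : ℂ) r, ‖f z‖ₑ ^ 2 ≤ C * ∫⁻ w, ‖f w‖ₑ ^ 2 ∂(weightMeasure v) := by
  obtain ⟨R, hrR, hR⟩ := exists_between hr
  obtain ⟨δ, hδ, hvδ⟩ := hpos R hR
  have hI := setLIntegral_Ioo_ofReal_ne_zero (sub_pos.2 hrR)
  have hδ0 : ENNReal.ofReal δ ≠ 0 := by simpa using hδ
  refine ⟨ENNReal.ofReal Real.pi * (ENNReal.ofReal δ)⁻¹ *
    (∫⁻ r in Set.Ioo 0 (R - r), ENNReal.ofReal r)⁻¹, by finiteness, fun f hf z hz => ?_⟩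
  have hsub : ball z (R - r) ⊆ ball 0 R := ball_subset_ball' (by
    linarith [mem_closedBall.1 hz])
  have hsub1 : ball (0 : ℂ) R ⊆ ball 0 1 := ball_subset_ball hR.le
  have hweight : ENNReal.ofReal δ * ∫⁻ w in ball 0 R, ‖f w‖ₑ ^ 2 ∂dA ≤
      ∫⁻ w, ‖f w‖ₑ ^ 2 ∂(weightMeasure v) := by
    rw [lintegral_weightMeasure hv, ← lintegral_const_mul' _ _ (by simp)]
    refine (lintegral_mono_ae ?_).trans (lintegral_mono_set hsub1)
    filter_upwards [hvδ] with w hw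
    gcongr
  have hmean := (enorm_sq_mul_le_setLIntegral_ball (hf.mono (hsub.trans hsub1))).trans
    (lintegral_mono_set hsub)
  rw [setLIntegral_volume_eq_dA] at hmean
  calc _ ≤ (ENNReal.ofReal Real.pi * ∫⁻ w in ball 0 R, ‖f w‖ₑ ^ 2 ∂dA) /
        ∫⁻ r in Set.Ioo 0 (R - r), ENNReal.ofReal r :=
      (ENNReal.le_div_iff_mul_le (.inl hI) (.inl (setLIntegral_Ioo_ofReal_ne_top _))).2 hmean
    _ ≤ (ENNReal.ofReal Real.pi * ((∫⁻ w, ‖f w‖ₑ ^ 2 ∂(weightMeasure v)) / ENNReal.ofReal δ)) /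
        ∫⁻ r in Set.Ioo 0 (R - r), ENNReal.ofReal r := by
      gcongr
      rw [ENNReal.le_div_iff_mul_le (.inl hδ0) (.inl (by simp)), mul_comm]
      exact hweight
    _ = _ := by
      simp only [div_eq_mul_inv]
      ring

theorem lintegral_weightMeasure_dilation_le (hv : IntegrableOn v (ball (0 : ℂ) 1) dA)
    {r : ℝ} (hr : 0 < r) (hr1 : r < 1)
    (hmono : ∀ᵐ z ∂(dA.restrict (ball (0 : ℂ) 1)), v z ≤ v ((r : ℂ) * z)) (g : ℂ → ℝ≥0∞) :
    ∫⁻ z, g (r * z) ∂(weightMeasure v) ≤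
      ENNReal.ofReal (r ^ 2)⁻¹ * ∫⁻ z, g z ∂(weightMeasure v) := by
  rw [lintegral_weightMeasure hv, lintegral_weightMeasure hv,
    ← lintegral_indicator measurableSet_ball, ← lintegral_indicator measurableSet_ball,
    ← lintegral_dA_comp_mul_left hr]
  refine lintegral_mono_ae ?_
  filter_upwards [(ae_restrict_iff' measurableSet_ball).1 hmono] with z hz
  by_cases hzb : z ∈ ball (0 : ℂ) 1
  · have hrz : (r : ℂ) * z ∈ ball (0 : ℂ) 1 := by
      rw [mem_ball_zero_iff] at hzb ⊢
      rw [norm_mul, Complex.norm_real, Real.norm_of_nonneg hr.le]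
      nlinarith [norm_nonneg z]
    rw [Set.indicator_of_mem hzb, Set.indicator_of_mem hrz]
    gcongr
    exact hz hzb
  · simp [Set.indicator_of_notMem hzb]

theorem isDiskMeasure_weightMeasure (hv : IntegrableOn v (ball (0 : ℂ) 1) dA)
    (hpos : ∀ r : ℝ, r < 1 → ∃ δ > 0, ∀ᵐ z ∂(dA.restrict (ball (0 : ℂ) r)), δ < v z)
    (hmono : ∀ r : ℝ, 0 ≤ r → r < 1 →
      ∀ᵐ z ∂(dA.restrict (ball (0 : ℂ) 1)), v z ≤ v ((r : ℂ) * z)) :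
    IsDiskMeasure (weightMeasure v) where
  toIsFiniteMeasure := isFiniteMeasure_withDensity_ofReal hv.2
  ae_mem := (withDensity_absolutelyContinuous _ _).ae_le (ae_restrict_mem measurableSet_ball)
  bound _ hr := enorm_sq_le_mul_lintegral_weightMeasure hv hpos hr
  dilation r hr hr1 f _ :=
    lintegral_weightMeasure_dilation_le hv hr hr1 (hmono r hr.le hr1) fun z => ‖f z‖ₑ ^ 2

theorem integrable_weightMeasure_iff (hv : IntegrableOn v (ball (0 : ℂ) 1) dA)
    (hpos : ∀ᵐ z ∂(dA.restrict (ball (0 : ℂ) 1)), 0 < v z) (g : ℂ → ℝ) :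
    Integrable g (weightMeasure v) ↔ IntegrableOn (fun z => g z * v z) (ball 0 1) dA := by
  rw [weightMeasure, integrable_withDensity_iff_integrable_smul₀'
    hv.aestronglyMeasurable.aemeasurable.ennreal_ofReal (.of_forall fun _ => by simp)]
  refine integrable_congr ?_
  filter_upwards [hpos] with z hz
  rw [ENNReal.toReal_ofReal hz.le, smul_eq_mul, mul_comm]

theorem integral_weightMeasure (hv : IntegrableOn v (ball (0 : ℂ) 1) dA)
    (hpos : ∀ᵐ z ∂(dA.restrict (ball (0 : ℂ) 1)), 0 < v z) (g : ℂ → ℝ) :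
    ∫ z, g z ∂(weightMeasure v) = ∫ z in ball 0 1, g z * v z ∂dA := by
  rw [weightMeasure, integral_withDensity_eq_integral_toReal_smul₀
    hv.aestronglyMeasurable.aemeasurable.ennreal_ofReal (.of_forall fun _ => by simp)]
  refine integral_congr_ae ?_
  filter_upwards [hpos] with z hz
  rw [ENNReal.toReal_ofReal hz.le, smul_eq_mul, mul_comm]

theorem memHvn_iff [IsDiskMeasure (weightMeasure v)] (hv : IntegrableOn v (ball (0 : ℂ) 1) dA)
    (hpos : ∀ᵐ z ∂(dA.restrict (ball (0 : ℂ) 1)), 0 < v z) {n : ℕ} {f : ℂ → ℂ} :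
    MemHvn v n f ↔ DifferentiableOn ℂ f (ball 0 1) ∧
      ∀ k ≤ n, MemLp (iteratedDeriv k f) 2 (weightMeasure v) :=
  and_congr_right fun hf => forall₂_congr fun k _ => by
    rw [memLp_two_iff_integrable_sq_norm (hf.aestronglyMeasurable_iteratedDeriv k),
      integrable_weightMeasure_iff hv hpos]

end WeightMeasure

/-- For a weight `v ∈ L¹(𝔻)` with (i) `v > δ_r` a.e. on `r𝔻` for
every `r < 1` and (ii) `v(z) ≤ v(rz)` a.e. on `𝔻` for every `0 ≤ r < 1`, the space
`ℋ_{v,n}` is a Hilbert space of holomorphic functions on `𝔻` satisfying (P1)-(P3)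
(realized here as a `DiskHilbertSpace` whose members are exactly the functions of
`ℋ_{v,n}` and whose norm is `‖·‖_{v,n}`), and its maximal domain is contained in the
closed unit disk. -/
theorem hvn_is_diskHilbertSpace (v : ℂ → ℝ) (n : ℕ)
    (hvL1 : IntegrableOn v (ball (0 : ℂ) 1) dA)
    (hv_pos : ∀ r : ℝ, r < 1 → ∃ δ > 0, ∀ᵐ z ∂(dA.restrict (ball (0 : ℂ) r)), δ < v z)
    (hv_mono : ∀ r : ℝ, 0 ≤ r → r < 1 →
      ∀ᵐ z ∂(dA.restrict (ball (0 : ℂ) 1)), v z ≤ v ((r : ℂ) * z)) :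
    ∃ H : DiskHilbertSpace,
      (∀ F : H.carrier, MemHvn v n (H.toFun F)) ∧
      (∀ f : ℂ → ℂ, MemHvn v n f →
        ∃ F : H.carrier, Set.EqOn (H.toFun F) f (ball (0 : ℂ) 1)) ∧
      (∀ F : H.carrier, ‖F‖ ^ 2 = diskNormSq v n (H.toFun F)) ∧
      H.maxDomain ⊆ closedBall (0 : ℂ) 1 := by
  have hpos := ae_pos_of_ae_lt_on_balls hv_pos
  have := isDiskMeasure_weightMeasure hvL1 hv_pos hv_mono
  refine ⟨sobolevDiskSpace (weightMeasure v) n, fun F => ?_, fun f hf => ?_, fun F => ?_,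
    sobolevDiskSpace_maxDomain_subset _ n⟩
  · have hF := ((sobolevEquiv (weightMeasure v) n).symm F).2
    exact (memHvn_iff hvL1 hpos).2 ⟨hF.1, hF.2.2⟩
  · rw [memHvn_iff hvL1 hpos] at hf
    exact sobolevDiskSpace_exists_toFun_eqOn _ n hf.1 hf.2
  · have h := norm_sobolevDiskSpace_sq (weightMeasure v) n F
    simp only [integral_weightMeasure hvL1 hpos] at h
    exact h
end

section
/- Let Γ ⊆ 𝕋 be a subset of the unit circle that is both F_σ (a countable union of closed sets) and G_δ (a countable intersection of open sets). Then there exists a Hilbert space ℋ of holomorphic functions on 𝔻 in which polynomials are dense, point evaluations at points of 𝔻 are continuous, and the shift operator F ↦ zF is bounded, such that Ω_max = 𝔻 ∪ Γ. -/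
open Metric

open Polynomial
open scoped ENNReal
open Topology

namespace DiskHilbertSpace

section SquareSummable

variable {ι : Type*}

/-- Membership in `ℓ²` is square summability. -/
theorem memℓp_two_of_summable_sq {f : ι → ℝ} (hf : Summable fun i => f i ^ 2) :
    Memℓp f 2 :=
  memℓp_gen (by simpa using hf)

theorem norm_apply_le (f : lp (fun _ : ι => ℂ) 2) (i : ι) : ‖f i‖ ≤ ‖f‖ :=
  lp.norm_apply_le_norm (by simp) f i

/-- A pointwise bound by a constant multiple of an `ℓ²` function bounds the norm. -/
theorem norm_le_mul_norm {f : lp (fun _ : ι => ℂ) 2} {g : lp (fun _ : ι => ℝ) 2} {c : ℝ}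
    (hc : 0 ≤ c) (h : ∀ i, ‖f i‖ ≤ c * ‖g i‖) : ‖f‖ ≤ c * ‖g‖ := by
  have h1 : ‖f‖ ≤ ‖c • g‖ := lp.norm_mono (by simp) fun i => by
    simpa [abs_of_nonneg hc] using h i
  rwa [lp.norm_const_smul (by simp), Real.norm_of_nonneg hc] at h1

/-- A perturbation by a pointwise contraction. -/
theorem norm_le_add_of_apply_eq {f g h : lp (fun _ : ι => ℂ) 2} {c : ι → ℂ}
    (hc : ∀ i, ‖c i‖ ≤ 1) (hf : ∀ i, f i = c i * g i + h i) : ‖f‖ ≤ ‖g‖ + ‖h‖ := by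
  have h1 : ‖f - h‖ ≤ ‖g‖ := lp.norm_mono (by simp) fun i => by
    rw [lp.coeFn_sub, Pi.sub_apply, hf i, add_sub_cancel_right, norm_mul]
    exact mul_le_of_le_one_left (norm_nonneg _) (hc i)
  calc ‖f‖ = ‖(f - h) + h‖ := by rw [sub_add_cancel]
    _ ≤ ‖g‖ + ‖h‖ := (norm_add_le _ _).trans (by gcongr)

end SquareSummable

section PowerSeries

theorem summable_coeff_mul_pow (f : lp (fun _ : ℕ => ℂ) 2) {z : ℂ} (hz : ‖z‖ < 1) :
    Summable fun m => f m * z ^ m := by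
  refine Summable.of_norm_bounded
    ((summable_geometric_of_lt_one (norm_nonneg z) hz).mul_left ‖f‖) fun m => ?_
  rw [norm_mul, norm_pow]
  gcongr
  exact norm_apply_le f m

/-- Summation of the power series with square summable coefficients at a point of the disk. -/
noncomputable def powerSum (z : ℂ) (hz : ‖z‖ < 1) : lp (fun _ : ℕ => ℂ) 2 →L[ℂ] ℂ :=
  LinearMap.mkContinuous
    { toFun := fun f => ∑' m, f m * z ^ m
      map_add' := fun f g => by
        rw [← (summable_coeff_mul_pow f hz).tsum_add (summable_coeff_mul_pow g hz)]
        simp [add_mul]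
      map_smul' := fun c f => by
        simp [← tsum_mul_left, mul_assoc] }
    (1 - ‖z‖)⁻¹ fun f => by
      have h := tsum_of_norm_bounded (f := fun m => f m * z ^ m)
        ((hasSum_geometric_of_lt_one (norm_nonneg z) hz).mul_left ‖f‖) fun m => by
          rw [norm_mul, norm_pow]
          gcongr
          exact norm_apply_le f m
      rw [mul_comm]
      exact h

theorem powerSum_apply {z : ℂ} (hz : ‖z‖ < 1) (f : lp (fun _ : ℕ => ℂ) 2) :
    powerSum z hz f = ∑' m, f m * z ^ m := rfl

theorem hasFPowerSeriesOnBall_tsum (f : lp (fun _ : ℕ => ℂ) 2) :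
    HasFPowerSeriesOnBall (fun z : ℂ => ∑' m, f m * z ^ m)
      (FormalMultilinearSeries.ofScalars ℂ f) 0 1 := by
  have hr : (1 : ℝ≥0∞) ≤ (FormalMultilinearSeries.ofScalars ℂ (f : ℕ → ℂ)).radius := by
    have := (FormalMultilinearSeries.ofScalars ℂ (f : ℕ → ℂ)).le_radius_of_bound
      (r := 1) ‖f‖ fun n => by
        simpa [FormalMultilinearSeries.ofScalars_norm] using norm_apply_le f n
    simpa using this
  have h := ((FormalMultilinearSeries.ofScalars ℂ (f : ℕ → ℂ)).hasFPowerSeriesOnBall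
    (zero_lt_one.trans_le hr)).mono zero_lt_one hr
  convert h using 2 with z
  exact (FormalMultilinearSeries.ofScalars_sum_eq (f : ℕ → ℂ) z).symm

theorem coeff_eq_of_tsum_eqOn {f g : lp (fun _ : ℕ => ℂ) 2}
    (h : Set.EqOn (fun z : ℂ => ∑' m, f m * z ^ m) (fun z => ∑' m, g m * z ^ m)
      (ball 0 1)) : f = g := by
  have h1 := HasFPowerSeriesAt.eq_formalMultilinearSeries_of_eventually
    (hasFPowerSeriesOnBall_tsum f).hasFPowerSeriesAt
    (hasFPowerSeriesOnBall_tsum g).hasFPowerSeriesAt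
    (Filter.eventually_of_mem (ball_mem_nhds 0 one_pos) h)
  exact lp.ext (FormalMultilinearSeries.ofScalars_series_injective ℂ ℂ h1)

end PowerSeries

section Coefficients

/-- The coefficient sequence of a polynomial, in `ℓ²`. -/
noncomputable def coeffSeq : ℂ[X] →ₗ[ℂ] lp (fun _ : ℕ => ℂ) 2 where
  toFun p := ⟨p.coeff, memℓp_gen (summable_of_hasFiniteSupport
    (p.support.finite_toSet.subset fun m hm => by
      simp only [Function.mem_support] at hm
      simp only [Finset.mem_coe, mem_support_iff]
      intro h0
      simp [h0] at hm))⟩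
  map_add' p q := by ext m; exact coeff_add p q m
  map_smul' c p := by ext m; simp

@[simp]
theorem coeffSeq_apply (p : ℂ[X]) (m : ℕ) : coeffSeq p m = p.coeff m := rfl

theorem norm_coeffSeq_sq (p : ℂ[X]) {n : ℕ} (hn : p.natDegree < n) :
    ‖coeffSeq p‖ ^ 2 = ∑ m ∈ Finset.range n, ‖p.coeff m‖ ^ 2 := by
  have h := lp.norm_rpow_eq_tsum (p := 2) (by simp) (coeffSeq p)
  simp only [ENNReal.toReal_ofNat, Real.rpow_ofNat, coeffSeq_apply] at h
  rw [h, tsum_eq_sum]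
  intro m hm
  rw [coeff_eq_zero_of_natDegree_lt (hn.trans_le (by simpa using hm))]
  simp

theorem norm_coeffSeq_X_mul (p : ℂ[X]) : ‖coeffSeq (X * p)‖ = ‖coeffSeq p‖ := by
  have h1 : (X * p).natDegree < p.natDegree + 1 + 1 := by
    have := natDegree_mul_le (p := X) (q := p)
    rw [natDegree_X] at this
    lia
  rw [← sq_eq_sq₀ (norm_nonneg _) (norm_nonneg _), norm_coeffSeq_sq _ h1,
    norm_coeffSeq_sq p (Nat.lt_succ_self _), Finset.sum_range_succ']
  simp

theorem powerSum_coeffSeq {z : ℂ} (hz : ‖z‖ < 1) (p : ℂ[X]) :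
    powerSum z hz (coeffSeq p) = p.eval z := by
  rw [powerSum_apply, eval_eq_sum_range, tsum_eq_sum]
  · rfl
  intro m hm
  rw [coeffSeq_apply, coeff_eq_zero_of_natDegree_lt (by simpa using hm), zero_mul]

end Coefficients

theorem norm_pow_sub_pow_le_mul {x y : ℂ} (hx : ‖x‖ ≤ 1) (hy : ‖y‖ ≤ 1) (n : ℕ) :
    ‖x ^ n - y ^ n‖ ≤ n * ‖x - y‖ := by
  induction n with
  | zero => simp
  | succ n ih =>
    have h : x ^ (n + 1) - y ^ (n + 1) = x * (x ^ n - y ^ n) + (x - y) * y ^ n := by ring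
    calc ‖x ^ (n + 1) - y ^ (n + 1)‖
        ≤ ‖x‖ * ‖x ^ n - y ^ n‖ + ‖x - y‖ * ‖y‖ ^ n := by
          rw [h]; exact (norm_add_le _ _).trans (by simp)
      _ ≤ 1 * (n * ‖x - y‖) + ‖x - y‖ * 1 := by
          gcongr
          exact pow_le_one₀ (norm_nonneg _) hy
      _ = (n + 1 : ℕ) * ‖x - y‖ := by push_cast; ring

theorem exists_norm_eval_sub_le (p : ℂ[X]) : ∃ C : ℝ, 0 ≤ C ∧ ∀ x y : ℂ, ‖x‖ ≤ 1 → ‖y‖ ≤ 1 →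
    ‖p.eval x - p.eval y‖ ≤ C * ‖x - y‖ := by
  refine ⟨∑ m ∈ Finset.range (p.natDegree + 1), ‖p.coeff m‖ * m, by positivity,
    fun x y hx hy => ?_⟩
  rw [eval_eq_sum_range, eval_eq_sum_range, ← Finset.sum_sub_distrib, Finset.sum_mul]
  refine norm_sum_le_of_le _ fun m _ => ?_
  rw [← mul_sub, norm_mul, mul_assoc]
  gcongr
  exact norm_pow_sub_pow_le_mul hx hy m

theorem exists_norm_eval_le (p : ℂ[X]) : ∃ C : ℝ, 0 ≤ C ∧ ∀ x : ℂ, ‖x‖ ≤ 1 → ‖p.eval x‖ ≤ C := by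
  refine ⟨∑ m ∈ Finset.range (p.natDegree + 1), ‖p.coeff m‖, by positivity, fun x hx => ?_⟩
  rw [eval_eq_sum_range]
  refine norm_sum_le_of_le _ fun m _ => ?_
  rw [norm_mul, norm_pow]
  exact mul_le_of_le_one_right (norm_nonneg _) (pow_le_one₀ (norm_nonneg _) hx)

/-- A weighted family of pairs of points of the disk. -/
structure EdgeSystem (ι : Type) where
  src : ι → ℂ
  tgt : ι → ℂ
  weight : ι → ℝ
  norm_src : ∀ i, ‖src i‖ < 1
  norm_tgt : ∀ i, ‖tgt i‖ < 1
  weight_pos : ∀ i, 0 < weight i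
  summable : Summable fun i => (weight i * ‖src i - tgt i‖) ^ 2

namespace EdgeSystem

variable {ι : Type} (E : EdgeSystem ι)

/-- The weighted edge lengths, in `ℓ²`. -/
noncomputable def length : lp (fun _ : ι => ℝ) 2 :=
  ⟨fun i => E.weight i * ‖E.src i - E.tgt i‖, memℓp_two_of_summable_sq E.summable⟩

theorem norm_length_apply (i : ι) : ‖E.length i‖ = E.weight i * ‖E.src i - E.tgt i‖ :=
  Real.norm_of_nonneg (mul_nonneg (E.weight_pos i).le (norm_nonneg _))

/-- The weighted differences of a polynomial along the edges. -/
noncomputable def diff : ℂ[X] →ₗ[ℂ] lp (fun _ : ι => ℂ) 2 where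
  toFun p := ⟨fun i => E.weight i * (p.eval (E.src i) - p.eval (E.tgt i)), by
    obtain ⟨C, hC, h⟩ := exists_norm_eval_sub_le p
    refine ((lp.memℓp E.length).norm.const_mul C).mono fun i => ?_
    rw [norm_length_apply, norm_mul, Complex.norm_of_nonneg (E.weight_pos i).le, mul_left_comm]
    exact mul_le_mul_of_nonneg_left (h _ _ (E.norm_src i).le (E.norm_tgt i).le)
      (E.weight_pos i).le⟩
  map_add' p q := by
    ext i
    rw [lp.coeFn_add, Pi.add_apply]
    simp only [eval_add]
    ring
  map_smul' c p := by ext i; simp; ring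

@[simp]
theorem diff_apply (p : ℂ[X]) (i : ι) :
    E.diff p i = E.weight i * (p.eval (E.src i) - p.eval (E.tgt i)) := rfl

/-- The weighted values of a polynomial at the ends of the edges. -/
noncomputable def value : ℂ[X] →ₗ[ℂ] lp (fun _ : ι => ℂ) 2 where
  toFun p := ⟨fun i => E.weight i * (E.src i - E.tgt i) * p.eval (E.tgt i), by
    obtain ⟨C, hC, h⟩ := exists_norm_eval_le p
    refine ((lp.memℓp E.length).norm.const_mul C).mono fun i => ?_
    rw [norm_length_apply, norm_mul, norm_mul, Complex.norm_of_nonneg (E.weight_pos i).le,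
      mul_comm]
    have := E.weight_pos i
    gcongr
    exact h _ (E.norm_tgt i).le⟩
  map_add' p q := by
    ext i
    rw [lp.coeFn_add, Pi.add_apply]
    simp only [eval_add]
    ring
  map_smul' c p := by ext i; simp; ring

@[simp]
theorem value_apply (p : ℂ[X]) (i : ι) :
    E.value p i = E.weight i * (E.src i - E.tgt i) * p.eval (E.tgt i) := rfl

theorem norm_diff_X_mul_le (p : ℂ[X]) : ‖E.diff (X * p)‖ ≤ ‖E.diff p‖ + ‖E.value p‖ :=
  norm_le_add_of_apply_eq (c := E.src) (fun i => (E.norm_src i).le) fun i => by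
    simp; ring

theorem norm_value_X_mul_le (p : ℂ[X]) : ‖E.value (X * p)‖ ≤ ‖E.value p‖ :=
  lp.norm_mono (by simp) fun i => by
    simp only [value_apply, eval_mul, eval_X, norm_mul]
    rw [mul_left_comm]
    refine mul_le_of_le_one_left (by positivity) (E.norm_tgt i).le

/-- The ambient Hilbert space. -/
abbrev Ambient (ι : Type) : Type :=
  WithLp 2 (lp (fun _ : ℕ => ℂ) 2 × WithLp 2 (lp (fun _ : ι => ℂ) 2 × lp (fun _ : ι => ℂ) 2))

/-- The embedding of the polynomials in the ambient Hilbert space. -/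
noncomputable def embed :  ℂ[X] →ₗ[ℂ] Ambient ι :=
  (WithLp.linearEquiv 2 ℂ _).symm.toLinearMap ∘ₗ
    coeffSeq.prod ((WithLp.linearEquiv 2 ℂ _).symm.toLinearMap ∘ₗ E.diff.prod E.value)

theorem norm_embed_sq (p : ℂ[X]) :
    ‖E.embed p‖ ^ 2 = ‖coeffSeq p‖ ^ 2 + (‖E.diff p‖ ^ 2 + ‖E.value p‖ ^ 2) := by
  rw [WithLp.prod_norm_sq_eq_of_L2, WithLp.prod_norm_sq_eq_of_L2]
  rfl

theorem norm_coeffSeq_le (p : ℂ[X]) : ‖coeffSeq p‖ ≤ ‖E.embed p‖ :=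
  le_of_sq_le_sq (by rw [norm_embed_sq]; nlinarith [sq_nonneg ‖E.diff p‖]) (norm_nonneg _)

theorem norm_diff_le (p : ℂ[X]) : ‖E.diff p‖ ≤ ‖E.embed p‖ :=
  le_of_sq_le_sq (by rw [norm_embed_sq]; nlinarith [sq_nonneg ‖E.value p‖]) (norm_nonneg _)

theorem norm_value_le (p : ℂ[X]) : ‖E.value p‖ ≤ ‖E.embed p‖ :=
  le_of_sq_le_sq (by rw [norm_embed_sq]; nlinarith [sq_nonneg ‖E.diff p‖]) (norm_nonneg _)

theorem norm_embed_le (p : ℂ[X]) : ‖E.embed p‖ ≤ ‖coeffSeq p‖ + ‖E.diff p‖ + ‖E.value p‖ := by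
  refine le_of_sq_le_sq ?_ (by positivity)
  rw [norm_embed_sq]
  nlinarith [mul_nonneg (norm_nonneg (coeffSeq p)) (norm_nonneg (E.diff p)),
    mul_nonneg (norm_nonneg (coeffSeq p)) (norm_nonneg (E.value p)),
    mul_nonneg (norm_nonneg (E.diff p)) (norm_nonneg (E.value p))]

theorem norm_embed_X_mul_le (p : ℂ[X]) : ‖E.embed (X * p)‖ ≤ 4 * ‖E.embed p‖ := by
  have h := E.norm_embed_le (X * p)
  rw [norm_coeffSeq_X_mul] at h
  linarith [E.norm_diff_X_mul_le p, E.norm_value_X_mul_le p, E.norm_coeffSeq_le p,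
    E.norm_diff_le p, E.norm_value_le p]

/-- The closure of the polynomials in the ambient Hilbert space. -/
noncomputable abbrev closedRange : Submodule ℂ (Ambient ι) := (LinearMap.range E.embed).topologicalClosure

/-- The closure of the polynomials, as a Hilbert space. -/
def Carrier : Type := E.closedRange

noncomputable instance : NormedAddCommGroup E.Carrier :=
  inferInstanceAs (NormedAddCommGroup E.closedRange)

noncomputable instance : InnerProductSpace ℂ E.Carrier :=
  inferInstanceAs (InnerProductSpace ℂ E.closedRange)

instance : CompleteSpace E.Carrier :=
  inferInstanceAs (CompleteSpace E.closedRange)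

/-- The inclusion in the ambient Hilbert space. -/
noncomputable def incl : E.Carrier →L[ℂ] Ambient ι := E.closedRange.subtypeL

theorem incl_injective : Function.Injective E.incl := Subtype.val_injective

/-- The polynomials as elements of the closure. -/
noncomputable def polyMap : ℂ[X] →ₗ[ℂ] E.Carrier :=
  LinearMap.codRestrict E.closedRange E.embed fun p =>
    Submodule.le_topologicalClosure _ (LinearMap.mem_range_self _ p)

theorem denseRange_polyMap : DenseRange E.polyMap := by
  intro F
  have hi : IsInducing E.incl := Topology.IsInducing.subtypeVal
  rw [hi.closure_eq_preimage_closure_image, ← Set.range_comp]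
  exact F.2

theorem polyMap_induction {Y : Type*} [TopologicalSpace Y] [T2Space Y] {f g : E.Carrier → Y}
    (hf : Continuous f) (hg : Continuous g) (h : ∀ p, f (E.polyMap p) = g (E.polyMap p))
    (F : E.Carrier) : f F = g F :=
  congrFun (E.denseRange_polyMap.equalizer hf hg (funext h)) F

open Classical in
/-- The realization of elements of the closure as functions on the disk. -/
noncomputable def realize : E.Carrier →ₗ[ℂ] (ℂ → ℂ) :=
  LinearMap.pi fun z => if hz : ‖z‖ < 1 then
    (powerSum z hz).toLinearMap ∘ₗ (WithLp.fstₗ 2 ℂ _ _) ∘ₗ E.incl.toLinearMap else 0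

theorem realize_apply {z : ℂ} (hz : ‖z‖ < 1) (F : E.Carrier) :
    E.realize F z = powerSum z hz (E.incl F).fst := by
  simp [realize, hz]

theorem continuous_realize {z : ℂ} (hz : ‖z‖ < 1) : Continuous fun F => E.realize F z := by
  simp_rw [E.realize_apply hz]
  fun_prop

theorem realize_polyMap {z : ℂ} (hz : ‖z‖ < 1) (p : ℂ[X]) :
    E.realize (E.polyMap p) z = p.eval z := by
  rw [realize_apply E hz, ← powerSum_coeffSeq hz]
  rfl

theorem diff_eq_realize (F : E.Carrier) (i : ι) :
    (E.incl F).snd.fst i = E.weight i * (E.realize F (E.src i) - E.realize F (E.tgt i)) := by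
  refine E.polyMap_induction (f := fun F : E.Carrier => (E.incl F).snd.fst i)
    (g := fun F => E.weight i * (E.realize F (E.src i) - E.realize F (E.tgt i))) ?_ ?_ ?_ F
  · exact (lp.lipschitzWith_one_eval (E := fun _ : ι => ℂ) 2 i).continuous.comp (by fun_prop)
  · exact continuous_const.mul
      ((E.continuous_realize (E.norm_src i)).sub (E.continuous_realize (E.norm_tgt i)))
  · intro p
    rw [realize_polyMap E (E.norm_src i), realize_polyMap E (E.norm_tgt i)]
    rfl

theorem value_eq_realize (F : E.Carrier) (i : ι) :
    (E.incl F).snd.snd i = E.weight i * (E.src i - E.tgt i) * E.realize F (E.tgt i) := by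
  refine E.polyMap_induction (f := fun F : E.Carrier => (E.incl F).snd.snd i)
    (g := fun F => E.weight i * (E.src i - E.tgt i) * E.realize F (E.tgt i)) ?_ ?_ ?_ F
  · exact (lp.lipschitzWith_one_eval (E := fun _ : ι => ℂ) 2 i).continuous.comp (by fun_prop)
  · exact continuous_const.mul (E.continuous_realize (E.norm_tgt i))
  · intro p
    rw [realize_polyMap E (E.norm_tgt i)]
    rfl

theorem realize_injOn (F G : E.Carrier)
    (h : Set.EqOn (E.realize F) (E.realize G) (ball (0 : ℂ) 1)) : F = G := by
  have h1 : (E.incl F).fst = (E.incl G).fst := coeff_eq_of_tsum_eqOn fun z hz => by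
    have hz' : ‖z‖ < 1 := by simpa using hz
    have := h hz
    rwa [E.realize_apply hz', E.realize_apply hz'] at this
  have hs i : E.realize F (E.src i) = E.realize G (E.src i) := h (by simpa using E.norm_src i)
  have ht i : E.realize F (E.tgt i) = E.realize G (E.tgt i) := h (by simpa using E.norm_tgt i)
  have h2 : (E.incl F).snd.fst = (E.incl G).snd.fst := by
    ext i
    rw [diff_eq_realize, diff_eq_realize, hs, ht]
  have h3 : (E.incl F).snd.snd = (E.incl G).snd.snd := by
    ext i
    rw [value_eq_realize, value_eq_realize, ht]
  refine E.incl_injective (WithLp.ofLp_injective 2 (Prod.ext h1 ?_))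
  exact WithLp.ofLp_injective 2 (Prod.ext h2 h3)

theorem differentiableOn_realize (F : E.Carrier) :
    DifferentiableOn ℂ (E.realize F) (ball (0 : ℂ) 1) := by
  have h := (hasFPowerSeriesOnBall_tsum (E.incl F).fst).differentiableOn
  have h1 : eball (0 : ℂ) 1 = ball 0 1 := by
    simpa using eball_ofReal (x := (0 : ℂ)) (ε := 1)
  rw [h1] at h
  refine h.congr fun z hz => ?_
  exact E.realize_apply (by simpa using hz) F

/-- Multiplication by the coordinate on the closure of the polynomials. -/
noncomputable def mulX : E.Carrier →L[ℂ] E.Carrier :=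
  (E.polyMap ∘ₗ LinearMap.mulLeft ℂ X).extendOfNorm E.polyMap

theorem mulX_polyMap (p : ℂ[X]) : E.mulX (E.polyMap p) = E.polyMap (X * p) :=
  LinearMap.extendOfNorm_eq E.denseRange_polyMap ⟨4, E.norm_embed_X_mul_le⟩ p

theorem realize_mulX {z : ℂ} (hz : ‖z‖ < 1) (F : E.Carrier) :
    E.realize (E.mulX F) z = z * E.realize F z := by
  refine E.polyMap_induction (f := fun F => E.realize (E.mulX F) z)
    (g := fun F => z * E.realize F z)
    ((E.continuous_realize hz).comp E.mulX.continuous)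
    (continuous_const.mul (E.continuous_realize hz)) (fun p => ?_) F
  simp only [mulX_polyMap, E.realize_polyMap hz, eval_mul, eval_X]

/-- The Hilbert space of holomorphic functions attached to an edge system. -/
noncomputable def toDiskHilbertSpace : DiskHilbertSpace :=
  DiskHilbertSpace.mk E.Carrier E.realize E.differentiableOn_realize E.realize_injOn
    E.polyMap (fun p z hz => E.realize_polyMap (by simpa using hz) p) E.denseRange_polyMap
    (fun z hz => E.continuous_realize (by simpa using hz)) E.mulX
    (fun F z hz => E.realize_mulX (by simpa using hz) F)

theorem mem_maxDomain_iff {w : ℂ} : w ∈ E.toDiskHilbertSpace.maxDomain ↔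
    ∃ C : ℝ, ∀ p : ℂ[X], ‖p.eval w‖ ≤ C * ‖E.embed p‖ := by
  constructor
  · rintro ⟨Λ, hΛ⟩
    exact ⟨‖Λ‖, fun p => hΛ p ▸ Λ.le_opNorm _⟩
  · rintro ⟨C, hC⟩
    exact ⟨(Polynomial.leval w).extendOfNorm E.polyMap,
      fun p => LinearMap.extendOfNorm_eq (f := Polynomial.leval w) E.denseRange_polyMap ⟨C, hC⟩ p⟩

theorem norm_eval_le_of_norm_lt_one {w : ℂ} (hw : ‖w‖ < 1) (p : ℂ[X]) :
    ‖p.eval w‖ ≤ ‖powerSum w hw‖ * ‖E.embed p‖ := by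
  rw [← powerSum_coeffSeq hw]
  exact (ContinuousLinearMap.le_opNorm _ _).trans (by gcongr; exact E.norm_coeffSeq_le p)

end EdgeSystem

section Averages

theorem norm_coeffSeq_X_pow_mul (p : ℂ[X]) (n : ℕ) : ‖coeffSeq (X ^ n * p)‖ = ‖coeffSeq p‖ := by
  induction n with
  | zero => simp
  | succ n ih => rw [pow_succ', mul_assoc, norm_coeffSeq_X_mul, ih]

/-- The average of the first `n` powers of a complex number. -/
noncomputable def powAvg (n : ℕ) (x : ℂ) : ℂ := (n : ℂ)⁻¹ * ∑ j ∈ Finset.range n, x ^ j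

theorem norm_powAvg_le_one (n : ℕ) {x : ℂ} (hx : ‖x‖ ≤ 1) : ‖powAvg n x‖ ≤ 1 := by
  have h : ‖∑ j ∈ Finset.range n, x ^ j‖ ≤ n := by
    refine (norm_sum_le_of_le _ (f := fun j => x ^ j) (n := fun _ => 1) fun j _ => ?_).trans
      (by simp)
    rw [norm_pow]
    exact pow_le_one₀ (norm_nonneg _) hx
  rw [powAvg, norm_mul, norm_inv, Complex.norm_natCast]
  calc (n : ℝ)⁻¹ * ‖∑ j ∈ Finset.range n, x ^ j‖ ≤ (n : ℝ)⁻¹ * n := by gcongr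
    _ ≤ 1 := inv_mul_le_one

theorem norm_powAvg_mul_le {n : ℕ} (hn : 0 < n) {x : ℂ} (hx : ‖x‖ ≤ 1) :
    ‖powAvg n x‖ * (n * ‖1 - x‖) ≤ 2 := by
  have hn' : (n : ℂ) ≠ 0 := by exact_mod_cast hn.ne'
  have h : powAvg n x * (n * (1 - x)) = 1 - x ^ n := by
    rw [← geom_sum_mul_neg, powAvg]
    field_simp
  calc ‖powAvg n x‖ * (n * ‖1 - x‖) = ‖1 - x ^ n‖ := by
        rw [← h, norm_mul, norm_mul, Complex.norm_natCast]
    _ ≤ 1 + 1 := (norm_sub_le _ _).trans (by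
        rw [norm_one, norm_pow]
        gcongr
        exact pow_le_one₀ (norm_nonneg _) hx)
    _ = 2 := by norm_num

theorem norm_powAvg_sub_le (n : ℕ) {x y : ℂ} (hx : ‖x‖ ≤ 1) (hy : ‖y‖ ≤ 1) :
    ‖powAvg n x - powAvg n y‖ ≤ n * ‖x - y‖ := by
  have h : ‖∑ j ∈ Finset.range n, (x ^ j - y ^ j)‖ ≤ n * (n * ‖x - y‖) := by
    refine (norm_sum_le_of_le _ (f := fun j => x ^ j - y ^ j) (n := fun _ => n * ‖x - y‖)
      fun j hj => (norm_pow_sub_pow_le_mul hx hy j).trans ?_).trans (by simp)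
    gcongr
    exact (Finset.mem_range.1 hj).le
  rw [powAvg, powAvg, ← mul_sub, ← Finset.sum_sub_distrib, norm_mul, norm_inv,
    Complex.norm_natCast]
  calc (n : ℝ)⁻¹ * ‖∑ j ∈ Finset.range n, (x ^ j - y ^ j)‖
      ≤ (n : ℝ)⁻¹ * (n * (n * ‖x - y‖)) := by gcongr
    _ = ((n : ℝ)⁻¹ * n) * (n * ‖x - y‖) := by ring
    _ ≤ 1 * (n * ‖x - y‖) := by gcongr; exact inv_mul_le_one
    _ = n * ‖x - y‖ := one_mul _

theorem norm_cube_sub_cube_le {a b : ℂ} {M : ℝ} (ha : ‖a‖ ≤ M) (hb : ‖b‖ ≤ M) :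
    ‖a ^ 3 - b ^ 3‖ ≤ ‖a - b‖ * (3 * M ^ 2) := by
  have h : a ^ 3 - b ^ 3 = (a - b) * (a * a + a * b + b * b) := by ring
  have hM : 0 ≤ M := (norm_nonneg _).trans ha
  rw [h, norm_mul]
  gcongr
  calc ‖a * a + a * b + b * b‖ ≤ ‖a‖ * ‖a‖ + ‖a‖ * ‖b‖ + ‖b‖ * ‖b‖ := by
        simpa using norm_add₃_le (a := a * a) (b := a * b) (c := b * b)
    _ ≤ M * M + M * M + M * M := by gcongr
    _ = 3 * M ^ 2 := by ring

/-- The polynomial averaging the first `n` powers of `z / ζ`. -/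
noncomputable def avgPoly (ζ : ℂ) (n : ℕ) : ℂ[X] :=
  ∑ j ∈ Finset.range n, C ((n : ℂ)⁻¹ * ζ⁻¹ ^ j) * X ^ j

theorem eval_avgPoly (ζ z : ℂ) (n : ℕ) : (avgPoly ζ n).eval z = powAvg n (ζ⁻¹ * z) := by
  simp [avgPoly, powAvg, eval_finsetSum, Finset.mul_sum, mul_pow, mul_assoc]

theorem norm_coeffSeq_avgPoly_mul_le {ζ : ℂ} (hζ : ‖ζ‖ = 1) (n : ℕ) (p : ℂ[X]) :
    ‖coeffSeq (avgPoly ζ n * p)‖ ≤ ‖coeffSeq p‖ := by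
  have h : avgPoly ζ n * p =
      ∑ j ∈ Finset.range n, ((n : ℂ)⁻¹ * ζ⁻¹ ^ j) • (X ^ j * p) := by
    rw [avgPoly, Finset.sum_mul]
    exact Finset.sum_congr rfl fun j _ => by rw [smul_eq_C_mul, mul_assoc]
  rw [h, map_sum]
  refine (norm_sum_le_of_le _ (n := fun _ => (n : ℝ)⁻¹ * ‖coeffSeq p‖) fun j _ => ?_).trans ?_
  · rw [map_smul, norm_smul, norm_coeffSeq_X_pow_mul]
    simp [hζ]
  · rw [Finset.sum_const, Finset.card_range, nsmul_eq_mul, ← mul_assoc]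
    exact mul_le_of_le_one_left (norm_nonneg _) mul_inv_le_one

theorem norm_coeffSeq_avgPoly_sq {ζ : ℂ} (hζ : ‖ζ‖ = 1) {n : ℕ} (hn : 0 < n) :
    ‖coeffSeq (avgPoly ζ n)‖ ^ 2 = (n : ℝ)⁻¹ := by
  have hcoeff m : (avgPoly ζ n).coeff m = if m < n then (n : ℂ)⁻¹ * ζ⁻¹ ^ m else 0 := by
    simp_rw [avgPoly, finsetSum_coeff, coeff_C_mul_X_pow, Finset.sum_ite_eq, Finset.mem_range]
  have hdeg : (avgPoly ζ n).natDegree < n := by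
    refine Nat.lt_of_le_sub_one hn (natDegree_le_iff_coeff_eq_zero.2 fun m hm => ?_)
    rw [hcoeff, if_neg (by lia)]
  rw [norm_coeffSeq_sq _ hdeg, Finset.sum_congr rfl (g := fun _ => ((n : ℝ)⁻¹) ^ 2)]
  · have : (n : ℝ) ≠ 0 := by exact_mod_cast hn.ne'
    rw [Finset.sum_const, Finset.card_range, nsmul_eq_mul]
    field_simp
  · intro m hm
    rw [hcoeff, if_pos (Finset.mem_range.1 hm)]
    simp [hζ]

end Averages

namespace EdgeSystem

variable {ι : Type} (E : EdgeSystem ι)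

theorem ball_subset_maxDomain : ball (0 : ℂ) 1 ⊆ E.toDiskHilbertSpace.maxDomain :=
  fun _ hw => E.mem_maxDomain_iff.2 ⟨_, E.norm_eval_le_of_norm_lt_one (by simpa using hw)⟩

/-- The endpoint of a chain of edges with summable reciprocal weights is in the domain. -/
theorem mem_maxDomain_of_chain {w : ℂ} {z : ℕ → ℂ} {e : ℕ → ι}
    (hz : Filter.Tendsto z Filter.atTop (𝓝 w)) (hsrc : ∀ n, E.src (e n) = z (n + 1))
    (htgt : ∀ n, E.tgt (e n) = z n) (hsum : Summable fun n => (E.weight (e n))⁻¹) :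
    w ∈ E.toDiskHilbertSpace.maxDomain := by
  have hz0 : ‖z 0‖ < 1 := htgt 0 ▸ E.norm_tgt (e 0)
  set S := ∑' n, (E.weight (e n))⁻¹
  refine E.mem_maxDomain_iff.2 ⟨‖powerSum (z 0) hz0‖ + S, fun p => ?_⟩
  have hpos n : 0 ≤ (E.weight (e n))⁻¹ := (inv_pos.2 (E.weight_pos _)).le
  have hstep n : ‖p.eval (z (n + 1)) - p.eval (z n)‖ ≤ (E.weight (e n))⁻¹ * ‖E.embed p‖ := by
    have h := (norm_apply_le (E.diff p) (e n)).trans (E.norm_diff_le p)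
    rw [diff_apply, norm_mul, Complex.norm_of_nonneg (E.weight_pos _).le, hsrc, htgt] at h
    rwa [inv_mul_eq_div, le_div_iff₀' (E.weight_pos _)]
  have hbound n : ‖p.eval (z n)‖ ≤ (‖powerSum (z 0) hz0‖ + S) * ‖E.embed p‖ := by
    have h1 : p.eval (z n) = p.eval (z 0) +
        ∑ m ∈ Finset.range n, (p.eval (z (m + 1)) - p.eval (z m)) := by
      rw [Finset.sum_range_sub (fun m => p.eval (z m))]
      ring
    rw [h1, add_mul]
    refine (norm_add_le _ _).trans (add_le_add (E.norm_eval_le_of_norm_lt_one hz0 p) ?_)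
    refine (norm_sum_le_of_le _ fun m _ => hstep m).trans ?_
    rw [← Finset.sum_mul]
    gcongr
    exact hsum.sum_le_tsum _ fun m _ => hpos m
  exact le_of_tendsto ((p.continuous.tendsto w).comp hz).norm (Filter.Eventually.of_forall hbound)

theorem norm_embed_X_pow_le (n : ℕ) :
    ‖E.embed (X ^ n)‖ ≤ ‖coeffSeq 1‖ + ‖E.diff 1‖ + (n + 1) * ‖E.value 1‖ := by
  have h1 : ‖coeffSeq (X ^ n)‖ = ‖coeffSeq 1‖ := by
    simpa using norm_coeffSeq_X_pow_mul 1 n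
  have h2 : ∀ n : ℕ, ‖E.value (X ^ n)‖ ≤ ‖E.value 1‖ := fun n => by
    induction n with
    | zero => simp
    | succ n ih => rw [pow_succ']; exact (E.norm_value_X_mul_le _).trans ih
  have h3 : ∀ n : ℕ, ‖E.diff (X ^ n)‖ ≤ ‖E.diff 1‖ + n * ‖E.value 1‖ := fun n => by
    induction n with
    | zero => simp
    | succ n ih =>
      rw [pow_succ']
      have := E.norm_diff_X_mul_le (X ^ n)
      push_cast
      linarith [h2 n]
  linarith [E.norm_embed_le (X ^ n), h2 n, h3 n]

theorem norm_le_one_of_mem_maxDomain {w : ℂ} (hw : w ∈ E.toDiskHilbertSpace.maxDomain) :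
    ‖w‖ ≤ 1 := by
  by_contra! h
  obtain ⟨C, hC⟩ := E.mem_maxDomain_iff.1 hw
  set K := ‖coeffSeq 1‖ + ‖E.diff 1‖ + ‖E.value 1‖
  set V := ‖E.value 1‖
  have hb (n : ℕ) : ‖w‖ ^ n ≤ |C| * (K + n * V) := by
    have h1 := hC (X ^ n)
    simp only [eval_pow, eval_X, norm_pow] at h1
    refine h1.trans ?_
    gcongr
    · exact le_abs_self C
    · exact (E.norm_embed_X_pow_le n).trans_eq (by ring)
  have ht : Filter.Tendsto (fun n : ℕ => |C| * (K * ((n : ℝ) ^ 0 / ‖w‖ ^ n) +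
      ((n : ℝ) ^ 1 / ‖w‖ ^ n) * V)) Filter.atTop (𝓝 (|C| * (K * 0 + 0 * V))) :=
    (((tendsto_pow_const_div_const_pow_of_one_lt 0 h).const_mul K).add
      ((tendsto_pow_const_div_const_pow_of_one_lt 1 h).mul_const V)).const_mul _
  have h1 : (1 : ℝ) ≤ |C| * (K * 0 + 0 * V) := ge_of_tendsto' ht fun n => by
    have hp : 0 < ‖w‖ ^ n := by positivity
    have h2 : |C| * (K * ((n : ℝ) ^ 0 / ‖w‖ ^ n) + ((n : ℝ) ^ 1 / ‖w‖ ^ n) * V) =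
        |C| * (K + n * V) / ‖w‖ ^ n := by
      field_simp
    rw [h2, le_div_iff₀ hp, one_mul]
    exact hb n
  norm_num at h1

/-- Evaluation at a point of the circle sufficiently separated from the edges is unbounded. -/
theorem notMem_maxDomain_of_separated {ζ : ℂ} (hζ : ‖ζ‖ = 1) {d : ι → ℝ} (hd : ∀ i, 0 < d i)
    (hsrc : ∀ i, d i ≤ ‖ζ - E.src i‖) (htgt : ∀ i, d i ≤ ‖ζ - E.tgt i‖)
    (hsum : Summable fun i => (E.weight i * ‖E.src i - E.tgt i‖ / d i ^ 2) ^ 2) :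
    ζ ∉ E.toDiskHilbertSpace.maxDomain := by
  intro hmem
  obtain ⟨C, hC⟩ := E.mem_maxDomain_iff.1 hmem
  have hζ0 : ζ ≠ 0 := by
    rintro rfl
    simp at hζ
  let τ : lp (fun _ : ι => ℝ) 2 := ⟨_, memℓp_two_of_summable_sq hsum⟩
  have hτ i : ‖τ i‖ = E.weight i * ‖E.src i - E.tgt i‖ / d i ^ 2 := by
    have := E.weight_pos i
    exact Real.norm_of_nonneg (by positivity)
  have hsep z : ‖1 - ζ⁻¹ * z‖ = ‖ζ - z‖ := by
    have : ζ - z = ζ * (1 - ζ⁻¹ * z) := by field_simp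
    rw [this, norm_mul, hζ, one_mul]
  have hball {z : ℂ} (hz : ‖z‖ < 1) : ‖ζ⁻¹ * z‖ ≤ 1 := by
    rw [norm_mul, norm_inv, hζ, inv_one, one_mul]; exact hz.le
  have hsmall {n : ℕ} (hn : 0 < n) {i : ι} {z : ℂ} (hz : ‖z‖ < 1) (h : d i ≤ ‖ζ - z‖) :
      ‖powAvg n (ζ⁻¹ * z)‖ ≤ 2 / (n * d i) := by
    have hn' : (0 : ℝ) < n := by exact_mod_cast hn
    have := hd i
    rw [le_div_iff₀ (by positivity)]
    refine le_trans ?_ (norm_powAvg_mul_le hn (hball hz))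
    rw [hsep]
    gcongr
  have heval n z : (avgPoly ζ n * (avgPoly ζ n * avgPoly ζ n)).eval z =
      powAvg n (ζ⁻¹ * z) ^ 3 := by
    simp only [eval_mul, eval_avgPoly]; ring
  have hone {n : ℕ} (hn : 0 < n) : powAvg n (ζ⁻¹ * ζ) = 1 := by
    have hn' : (n : ℂ) ≠ 0 := by exact_mod_cast hn.ne'
    simp [powAvg, hζ0, hn']
  have hcoeff {n : ℕ} (hn : 0 < n) :
      ‖coeffSeq (avgPoly ζ n * (avgPoly ζ n * avgPoly ζ n))‖ ≤ √((n : ℝ)⁻¹) := by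
    rw [← norm_coeffSeq_avgPoly_sq hζ hn, Real.sqrt_sq (norm_nonneg _)]
    exact (norm_coeffSeq_avgPoly_mul_le hζ n _).trans (norm_coeffSeq_avgPoly_mul_le hζ n _)
  have hdiff {n : ℕ} (hn : 0 < n) :
      ‖E.diff (avgPoly ζ n * (avgPoly ζ n * avgPoly ζ n))‖ ≤ 12 * (n : ℝ)⁻¹ * ‖τ‖ := by
    refine norm_le_mul_norm (by positivity) fun i => ?_
    have hn' : (0 : ℝ) < n := by exact_mod_cast hn
    have hdi := hd i
    have hw := E.weight_pos i
    rw [diff_apply, heval, heval, norm_mul, Complex.norm_of_nonneg hw.le, hτ]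
    have h1 := norm_cube_sub_cube_le (hsmall hn (E.norm_src i) (hsrc i))
      (hsmall hn (E.norm_tgt i) (htgt i))
    have h2 := norm_powAvg_sub_le n (hball (E.norm_src i)) (hball (E.norm_tgt i))
    rw [← mul_sub, norm_mul, norm_inv, hζ, inv_one, one_mul] at h2
    calc E.weight i * ‖powAvg n (ζ⁻¹ * E.src i) ^ 3 - powAvg n (ζ⁻¹ * E.tgt i) ^ 3‖
        ≤ E.weight i * ((n * ‖E.src i - E.tgt i‖) * (3 * (2 / (n * d i)) ^ 2)) := by
          gcongr
          exact h1.trans (by gcongr)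
      _ = 12 * (n : ℝ)⁻¹ * (E.weight i * ‖E.src i - E.tgt i‖ / d i ^ 2) := by
          field_simp
          ring
  have hvalue {n : ℕ} (hn : 0 < n) :
      ‖E.value (avgPoly ζ n * (avgPoly ζ n * avgPoly ζ n))‖ ≤ 4 * (n : ℝ)⁻¹ * ‖τ‖ := by
    refine norm_le_mul_norm (by positivity) fun i => ?_
    have hn' : (0 : ℝ) < n := by exact_mod_cast hn
    have hdi := hd i
    have hw := E.weight_pos i
    have hd2 : d i ≤ 2 := (hsrc i).trans
      ((norm_sub_le _ _).trans (by linarith [E.norm_src i]))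
    rw [value_apply, heval, norm_mul, norm_mul, Complex.norm_of_nonneg hw.le, hτ, norm_pow]
    calc E.weight i * ‖E.src i - E.tgt i‖ * ‖powAvg n (ζ⁻¹ * E.tgt i)‖ ^ 3
        ≤ E.weight i * ‖E.src i - E.tgt i‖ * (2 / (n * d i)) := by
          gcongr
          exact (pow_le_of_le_one (norm_nonneg _)
            (norm_powAvg_le_one n (hball (E.norm_tgt i))) three_ne_zero).trans
            (hsmall hn (E.norm_tgt i) (htgt i))
      _ = 2 * d i * (n : ℝ)⁻¹ * (E.weight i * ‖E.src i - E.tgt i‖ / d i ^ 2) := by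
          field_simp
      _ ≤ 4 * (n : ℝ)⁻¹ * (E.weight i * ‖E.src i - E.tgt i‖ / d i ^ 2) := by
          gcongr
          linarith
  have hinv : Filter.Tendsto (fun n : ℕ => (n : ℝ)⁻¹) Filter.atTop (𝓝 0) :=
    tendsto_inv_atTop_nhds_zero_nat
  have ht : Filter.Tendsto (fun n : ℕ => |C| * (√((n : ℝ)⁻¹) + 16 * ‖τ‖ * (n : ℝ)⁻¹))
      Filter.atTop (𝓝 (|C| * (√0 + 16 * ‖τ‖ * 0))) :=
    ((hinv.sqrt).add (hinv.const_mul _)).const_mul _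
  have h1 : (1 : ℝ) ≤ |C| * (√0 + 16 * ‖τ‖ * 0) := by
    refine ge_of_tendsto ht ((Filter.eventually_gt_atTop 0).mono fun n hn => ?_)
    have h2 := hC (avgPoly ζ n * (avgPoly ζ n * avgPoly ζ n))
    rw [heval, hone hn, one_pow, norm_one] at h2
    refine h2.trans ?_
    gcongr
    · exact le_abs_self C
    · refine (E.norm_embed_le _).trans ?_
      linarith [hcoeff hn, hdiff hn, hvalue hn]
  norm_num at h1

end EdgeSystem

section DyadicTree

/-- The point of the circle with normalized angle `t`. -/
noncomputable def circlePoint (t : ℝ) : ℂ := Complex.exp (Complex.I * (2 * Real.pi * t : ℝ))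

theorem norm_circlePoint (t : ℝ) : ‖circlePoint t‖ = 1 := by
  rw [circlePoint, mul_comm, Complex.norm_exp_ofReal_mul_I]

theorem norm_circlePoint_sub_le (s t : ℝ) :
    ‖circlePoint s - circlePoint t‖ ≤ 7 * |s - t| := by
  have h : circlePoint s - circlePoint t =
      circlePoint t * (Complex.exp (Complex.I * (2 * Real.pi * (s - t) : ℝ)) - 1) := by
    rw [circlePoint, circlePoint, mul_sub, mul_one, ← Complex.exp_add]
    congr 2
    push_cast
    ring
  rw [h, norm_mul, norm_circlePoint, one_mul]
  refine Real.norm_exp_I_mul_ofReal_sub_one_le.trans ?_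
  rw [Real.norm_eq_abs, abs_mul, abs_of_pos Real.two_pi_pos]
  gcongr
  linarith [Real.pi_lt_d2]

theorem exists_circlePoint_eq {w : ℂ} (hw : ‖w‖ = 1) :
    ∃ t : ℝ, 0 ≤ t ∧ t < 1 ∧ circlePoint t = w := by
  refine ⟨Int.fract (w.arg / (2 * Real.pi)), Int.fract_nonneg _, Int.fract_lt_one _, ?_⟩
  have hpi : (Real.pi : ℂ) ≠ 0 := by exact_mod_cast Real.pi_ne_zero
  have h : Complex.I * (2 * Real.pi * Int.fract (w.arg / (2 * Real.pi)) : ℝ) =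
      w.arg * Complex.I - (⌊w.arg / (2 * Real.pi)⌋ : ℂ) * (2 * Real.pi * Complex.I) := by
    rw [Int.fract]
    push_cast
    field_simp
  rw [circlePoint, h, Complex.exp_sub, Complex.exp_int_mul_two_pi_mul_I, div_one]
  simpa [hw] using Complex.norm_mul_exp_arg_mul_I w

/-- The `j`-th dyadic point of level `n` in the disk. -/
noncomputable def node (n j : ℕ) : ℂ := (1 - (1 / 2) ^ n : ℝ) * circlePoint (j / 2 ^ n)

theorem norm_node (n j : ℕ) : ‖node n j‖ = 1 - (1 / 2) ^ n := by
  rw [node, norm_mul, norm_circlePoint, mul_one, Complex.norm_of_nonneg]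
  exact sub_nonneg.2 (pow_le_one₀ (by norm_num) (by norm_num))

theorem norm_node_lt_one (n j : ℕ) : ‖node n j‖ < 1 := by
  rw [norm_node]
  exact sub_lt_self _ (by positivity)

theorem norm_node_floor_sub_le (n : ℕ) {t : ℝ} (ht : 0 ≤ t) :
    ‖node n ⌊2 ^ n * t⌋₊ - circlePoint t‖ ≤ 8 * (1 / 2) ^ n := by
  set s : ℝ := ⌊2 ^ n * t⌋₊ / 2 ^ n with hs
  have hst : |s - t| ≤ (1 / 2) ^ n := by
    have h1 := Nat.floor_le (show 0 ≤ 2 ^ n * t by positivity)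
    have h2 := Nat.lt_floor_add_one (2 ^ n * t)
    have h3 : s - t = (⌊2 ^ n * t⌋₊ - 2 ^ n * t) * (1 / 2) ^ n := by
      rw [hs, one_div, inv_pow]
      field_simp
    rw [h3, abs_mul, abs_of_pos (show (0 : ℝ) < (1 / 2) ^ n by positivity)]
    refine mul_le_of_le_one_left (by positivity) ?_
    rw [abs_le]
    constructor <;> linarith
  have h : node n ⌊2 ^ n * t⌋₊ - circlePoint t =
      (circlePoint s - circlePoint t) - ((1 / 2) ^ n : ℝ) * circlePoint s := by
    rw [node]
    push_cast
    ring
  rw [h]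
  refine (norm_sub_le _ _).trans ?_
  rw [norm_mul, norm_circlePoint, mul_one, Complex.norm_of_nonneg (by positivity)]
  linarith [norm_circlePoint_sub_le s t]

theorem floor_two_pow_succ_div_two (n : ℕ) (t : ℝ) :
    ⌊2 ^ (n + 1) * t⌋₊ / 2 = ⌊2 ^ n * t⌋₊ := by
  rw [← Nat.floor_div_ofNat, pow_succ]
  congr 1
  field_simp

/-- The distance from a point of the circle to the end of a branch is at most nine times its
distance to the nodes of the branch. -/
theorem norm_sub_circlePoint_le {ζ : ℂ} (hζ : ‖ζ‖ = 1) (n : ℕ) {t : ℝ} (ht : 0 ≤ t) :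
    ‖ζ - circlePoint t‖ ≤ 9 * ‖ζ - node n ⌊2 ^ n * t⌋₊‖ := by
  have h1 := norm_node_floor_sub_le n ht
  have h2 : (1 / 2 : ℝ) ^ n ≤ ‖ζ - node n ⌊2 ^ n * t⌋₊‖ := by
    have := norm_sub_norm_le ζ (node n ⌊2 ^ n * t⌋₊)
    rw [hζ, norm_node] at this
    linarith
  linarith [norm_sub_le_norm_sub_add_norm_sub ζ (node n ⌊2 ^ n * t⌋₊) (circlePoint t)]

/-- The dyadic edges along the branches ending in a member of a sequence of sets. -/
def TreeIndex (C : ℕ → Set ℂ) : Type :=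
  {x : ℕ × (Σ n : ℕ, Fin (2 ^ (n + 1))) // ∃ t : ℝ, 0 ≤ t ∧ circlePoint t ∈ C x.1 ∧
    ⌊2 ^ (x.2.1 + 1) * t⌋₊ = x.2.2}

namespace TreeIndex

variable {C : ℕ → Set ℂ}

/-- The index of the set in the sequence. -/
def stage (x : TreeIndex C) : ℕ := x.1.1

/-- The level of the lower end of the edge. -/
def level (x : TreeIndex C) : ℕ := x.1.2.1

/-- The upper end of the edge. -/
noncomputable def src (x : TreeIndex C) : ℂ := node (x.level + 1) x.1.2.2

/-- The lower end of the edge. -/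
noncomputable def tgt (x : TreeIndex C) : ℂ := node x.level (x.1.2.2 / 2)

theorem exists_eq_node (x : TreeIndex C) : ∃ t : ℝ, 0 ≤ t ∧ circlePoint t ∈ C x.stage ∧
    x.src = node (x.level + 1) ⌊2 ^ (x.level + 1) * t⌋₊ ∧
    x.tgt = node x.level ⌊2 ^ x.level * t⌋₊ := by
  obtain ⟨t, h0, hC, hj⟩ := x.2
  refine ⟨t, h0, hC, ?_, ?_⟩
  · rw [src, ← hj]
    rfl
  · rw [← floor_two_pow_succ_div_two, tgt, ← hj]
    rfl

theorem norm_src_sub_tgt_le (x : TreeIndex C) : ‖x.src - x.tgt‖ ≤ 12 * (1 / 2) ^ x.level := by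
  obtain ⟨t, h0, -, hs, ht⟩ := x.exists_eq_node
  have h1 := norm_node_floor_sub_le (x.level + 1) h0
  have h2 := norm_node_floor_sub_le x.level h0
  rw [← hs, pow_succ] at h1
  rw [← ht, norm_sub_rev] at h2
  linarith [norm_sub_le_norm_sub_add_norm_sub x.src (circlePoint t) x.tgt]

theorem summable_stage_mul_level {a : ℕ → ℝ} (ha : Summable a) (ha0 : ∀ k, 0 ≤ a k) :
    Summable fun x : TreeIndex C => a x.stage * (25 / 64) ^ x.level := by
  have h1 : Summable fun y : Σ n : ℕ, Fin (2 ^ (n + 1)) => (25 / 64 : ℝ) ^ y.1 := by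
    refine (summable_sigma_of_nonneg fun y => by positivity).2
      ⟨fun n => Summable.of_finite, ?_⟩
    have h2 : (fun n : ℕ => ∑' _ : Fin (2 ^ (n + 1)), (25 / 64 : ℝ) ^ n) =
        fun n => 2 * (25 / 32 : ℝ) ^ n := by
      funext n
      rw [tsum_fintype, Finset.sum_const, Finset.card_univ, Fintype.card_fin, nsmul_eq_mul]
      push_cast
      rw [pow_succ, mul_right_comm, ← mul_pow, mul_comm]
      norm_num
    rw [h2]
    exact (summable_geometric_of_lt_one (by norm_num) (by norm_num)).mul_left 2
  exact (ha.mul_of_nonneg h1 ha0 fun y => by positivity).comp_injective Subtype.val_injective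

end TreeIndex

theorem sq_mul_pow_mul_le {a l : ℝ} {n : ℕ} (hl : 0 ≤ l) (h : l ≤ 12 * (1 / 2) ^ n) :
    (a * (5 / 4) ^ n * l) ^ 2 ≤ 144 * (a ^ 2 * (25 / 64) ^ n) := by
  calc (a * (5 / 4) ^ n * l) ^ 2 = a ^ 2 * ((5 / 4) ^ n) ^ 2 * l ^ 2 := by ring
    _ ≤ a ^ 2 * ((5 / 4) ^ n) ^ 2 * (12 * (1 / 2) ^ n) ^ 2 := by gcongr
    _ = 144 * (a ^ 2 * ((5 / 4) ^ 2 * (1 / 2) ^ 2) ^ n) := by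
        rw [mul_pow ((5 / 4 : ℝ) ^ 2), pow_right_comm (5 / 4 : ℝ) 2 n,
          pow_right_comm (1 / 2 : ℝ) 2 n]
        generalize (5 / 4 : ℝ) ^ n = p, (1 / 2 : ℝ) ^ n = q
        ring
    _ = 144 * (a ^ 2 * (25 / 64) ^ n) := by norm_num

/-- The edge system of the dyadic branches ending in a sequence of sets. -/
noncomputable def treeSystem (C : ℕ → Set ℂ) {ε : ℕ → ℝ} (hε : ∀ k, 0 < ε k)
    (hsum : Summable fun k => ε k ^ 2) : EdgeSystem (TreeIndex C) where
  src := TreeIndex.src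
  tgt := TreeIndex.tgt
  weight x := ε x.stage * (5 / 4) ^ x.level
  norm_src _ := norm_node_lt_one _ _
  norm_tgt _ := norm_node_lt_one _ _
  weight_pos x := mul_pos (hε _) (by positivity)
  summable := Summable.of_nonneg_of_le (fun _ => sq_nonneg _)
    (fun x => sq_mul_pow_mul_le (norm_nonneg _) x.norm_src_sub_tgt_le)
    ((TreeIndex.summable_stage_mul_level hsum fun _ => sq_nonneg _).mul_left 144)

variable {C : ℕ → Set ℂ} {ε : ℕ → ℝ} (hε : ∀ k, 0 < ε k) (hsum : Summable fun k => ε k ^ 2)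

theorem mem_maxDomain_treeSystem {k : ℕ} {w : ℂ} (hw : ‖w‖ = 1) (hk : w ∈ C k) :
    w ∈ (treeSystem C hε hsum).toDiskHilbertSpace.maxDomain := by
  obtain ⟨t, h0, h1, rfl⟩ := exists_circlePoint_eq hw
  have hlt (n : ℕ) : ⌊2 ^ (n + 1) * t⌋₊ < 2 ^ (n + 1) := by
    rw [Nat.floor_lt (by positivity)]
    push_cast
    exact mul_lt_of_lt_one_right (by positivity) h1
  let e (n : ℕ) : TreeIndex C := ⟨(k, ⟨n, ⟨_, hlt n⟩⟩), t, h0, hk, rfl⟩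
  refine (treeSystem C hε hsum).mem_maxDomain_of_chain
    (z := fun n => node n ⌊2 ^ n * t⌋₊) (e := e) ?_ (fun n => rfl) (fun n => ?_) ?_
  · rw [tendsto_iff_norm_sub_tendsto_zero]
    refine squeeze_zero (fun n => norm_nonneg _) (fun n => norm_node_floor_sub_le n h0) ?_
    simpa using (tendsto_pow_atTop_nhds_zero_of_lt_one (r := (1 / 2 : ℝ))
      (by norm_num) (by norm_num)).const_mul 8
  · rw [← floor_two_pow_succ_div_two]
    rfl
  · have h2 : (fun n => ((treeSystem C hε hsum).weight (e n))⁻¹) =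
        fun n => (ε k)⁻¹ * (4 / 5) ^ n := by
      funext n
      change (ε k * (5 / 4) ^ n)⁻¹ = _
      rw [mul_inv, ← inv_pow]
      norm_num
    rw [h2]
    exact (summable_geometric_of_lt_one (by norm_num) (by norm_num)).mul_left _

theorem notMem_maxDomain_treeSystem {ζ : ℂ} (hζ : ‖ζ‖ = 1) {d : ℕ → ℝ} (hd : ∀ k, 0 < d k)
    (hdC : ∀ k, ∀ x ∈ C k, d k ≤ ‖ζ - x‖) (hdsum : Summable fun k => (ε k / d k ^ 2) ^ 2) :
    ζ ∉ (treeSystem C hε hsum).toDiskHilbertSpace.maxDomain := by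
  refine (treeSystem C hε hsum).notMem_maxDomain_of_separated hζ
    (d := fun x => d x.stage / 9) (fun x => by have := hd x.stage; positivity) ?_ ?_ ?_
  · intro x
    obtain ⟨t, h0, hC, hs, -⟩ := x.exists_eq_node
    change _ ≤ ‖ζ - x.src‖
    rw [hs]
    linarith [hdC _ _ hC, norm_sub_circlePoint_le hζ (x.level + 1) h0]
  · intro x
    obtain ⟨t, h0, hC, -, ht⟩ := x.exists_eq_node
    change _ ≤ ‖ζ - x.tgt‖
    rw [ht]
    linarith [hdC _ _ hC, norm_sub_circlePoint_le hζ x.level h0]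
  · refine Summable.of_nonneg_of_le (fun _ => sq_nonneg _) (fun x => ?_)
      ((TreeIndex.summable_stage_mul_level (C := C) hdsum fun _ => sq_nonneg _).mul_left
        (81 ^ 2 * 144))
    change (ε x.stage * (5 / 4) ^ x.level * ‖x.src - x.tgt‖ / (d x.stage / 9) ^ 2) ^ 2 ≤ _
    have h := sq_mul_pow_mul_le (a := ε x.stage / d x.stage ^ 2) (norm_nonneg _)
      x.norm_src_sub_tgt_le
    calc _ = 81 ^ 2 * (ε x.stage / d x.stage ^ 2 * (5 / 4) ^ x.level * ‖x.src - x.tgt‖) ^ 2 := by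
          ring
      _ ≤ _ := by linarith

end DyadicTree

theorem exists_pos_forall_le_norm_sub {s t : Set ℂ} (hs : IsCompact s) (ht : IsClosed t)
    (hst : Disjoint s t) : ∃ δ : ℝ, 0 < δ ∧ δ ≤ 1 ∧ ∀ x ∈ s, ∀ y ∈ t, δ ≤ ‖x - y‖ := by
  obtain ⟨r, hr, h⟩ := Metric.exists_pos_forall_lt_edist hs ht hst
  refine ⟨min r 1, lt_min hr one_pos, min_le_right _ _, fun x hx y hy => ?_⟩
  have h1 := h x hx y hy
  rw [edist_nndist, ENNReal.coe_lt_coe] at h1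
  rw [← dist_eq_norm]
  exact (min_le_left _ _).trans (NNReal.coe_lt_coe.2 h1).le

/-- Weights decaying fast in comparison with the distances of the pieces of an `F_σ` subset of the
circle to the points outside of it, for an `F_σ` set which is also `G_δ`. -/
theorem exists_weights {Γ : Set ℂ} {C U : ℕ → Set ℂ} (hC : ∀ k, IsClosed (C k))
    (hΓC : Γ = ⋃ k, C k) (hU : ∀ k, IsOpen (U k)) (hΓU : Γ = ⋂ k, U k) :
    ∃ ε : ℕ → ℝ, (∀ k, 0 < ε k) ∧ (Summable fun k => ε k ^ 2) ∧
      ∀ ζ : ℂ, ‖ζ‖ = 1 → ζ ∉ Γ → ∃ d : ℕ → ℝ, (∀ k, 0 < d k) ∧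
        (∀ k, ∀ x ∈ C k, d k ≤ ‖ζ - x‖) ∧ Summable fun k => (ε k / d k ^ 2) ^ 2 := by
  have hCΓ k : C k ⊆ Γ := hΓC ▸ Set.subset_iUnion C k
  let K (k : ℕ) : Set ℂ := sphere 0 1 ∩ ⋃ j ∈ Set.Iic k, (U j)ᶜ
  have hK k : IsCompact (K k) := (isCompact_sphere _ _).inter_right
    ((Set.finite_Iic k).isClosed_biUnion fun j _ => (hU j).isClosed_compl)
  have hKC k : Disjoint (K k) (C k) := by
    rw [Set.disjoint_left]
    rintro x ⟨-, hx⟩ hxC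
    obtain ⟨j, -, hxj⟩ := Set.mem_iUnion₂.1 hx
    have hxΓ : x ∈ ⋂ k, U k := hΓU ▸ hCΓ k hxC
    exact hxj (Set.mem_iInter.1 hxΓ j)
  choose δ hδ0 hδ1 hδ using fun k => exists_pos_forall_le_norm_sub (hK k) (hC k) (hKC k)
  have hgeom : Summable fun k : ℕ => ((1 / 2 : ℝ) ^ k) ^ 2 := by
    simp_rw [← pow_mul, mul_comm _ 2, pow_mul]
    exact summable_geometric_of_lt_one (by norm_num) (by norm_num)
  refine ⟨fun k => (1 / 2) ^ k * δ k ^ 2, fun k => by have := hδ0 k; positivity, ?_, ?_⟩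
  · refine Summable.of_nonneg_of_le (fun _ => sq_nonneg _) (fun k => ?_) hgeom
    have := hδ0 k
    gcongr
    exact mul_le_of_le_one_right (by positivity) (pow_le_one₀ this.le (hδ1 k))
  · intro ζ hζ hζΓ
    obtain ⟨j, hj⟩ : ∃ j, ζ ∉ U j := by
      simpa [hΓU] using hζΓ
    choose r hr0 _ hr using fun k => exists_pos_forall_le_norm_sub (isCompact_singleton (x := ζ))
      (hC k) (Set.disjoint_singleton_left.2 fun h => hζΓ (hCΓ k h))
    refine ⟨fun k => if j ≤ k then δ k else r k, fun k => ?_, fun k x hx => ?_, ?_⟩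
    · dsimp only
      split_ifs
      exacts [hδ0 k, hr0 k]
    · dsimp only
      split_ifs with hjk
      · exact hδ k ζ ⟨by simpa using hζ, Set.mem_biUnion hjk hj⟩ x hx
      · exact hr k ζ rfl x hx
    · rw [← summable_nat_add_iff j]
      refine ((summable_nat_add_iff j).2 hgeom).congr fun k => ?_
      have := (hδ0 (k + j)).ne'
      dsimp only
      rw [if_pos (Nat.le_add_left _ _)]
      field_simp

end DiskHilbertSpace

/-- For every `Γ ⊆ 𝕋` that is both `F_σ` (a countable union of
closed sets) and `G_δ` (a countable intersection of open sets), there exists a Hilbert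
space of holomorphic functions on `𝔻` satisfying (P1)-(P3) whose maximal domain is
`𝔻 ∪ Γ`. -/
theorem exists_diskHilbertSpace_maxDomain_eq (Γ : Set ℂ) (hΓ : Γ ⊆ sphere (0 : ℂ) 1)
    (hFσ : ∃ C : ℕ → Set ℂ, (∀ k, IsClosed (C k)) ∧ Γ = ⋃ k, C k)
    (hGδ : ∃ U : ℕ → Set ℂ, (∀ k, IsOpen (U k)) ∧ Γ = ⋂ k, U k) :
    ∃ H : DiskHilbertSpace, H.maxDomain = ball (0 : ℂ) 1 ∪ Γ := by
  obtain ⟨C, hC, hΓC⟩ := hFσ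
  obtain ⟨U, hU, hΓU⟩ := hGδ
  obtain ⟨ε, hε, hsum, hd⟩ := DiskHilbertSpace.exists_weights hC hΓC hU hΓU
  refine ⟨(DiskHilbertSpace.treeSystem C hε hsum).toDiskHilbertSpace,
    Set.Subset.antisymm (fun w hw => ?_) (Set.union_subset
      (DiskHilbertSpace.EdgeSystem.ball_subset_maxDomain _) fun w hw => ?_)⟩
  · by_contra hnot
    rw [Set.mem_union, not_or, mem_ball_zero_iff, not_lt] at hnot
    have h1 := le_antisymm
      (DiskHilbertSpace.EdgeSystem.norm_le_one_of_mem_maxDomain _ hw) hnot.1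
    obtain ⟨d, hd0, hdC, hds⟩ := hd w h1 hnot.2
    exact DiskHilbertSpace.notMem_maxDomain_treeSystem hε hsum h1 hd0 hdC hds hw
  · obtain ⟨k, hk⟩ := Set.mem_iUnion.1 (hΓC ▸ hw)
    exact DiskHilbertSpace.mem_maxDomain_treeSystem hε hsum (by simpa using hΓ hw) hk
end
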